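/- arXiv:math/0110186 — 12 statements merged into one kernel-verified Lean document; each statement's English description precedes it below -/
import Mathlib

section
/- For every ξ ∈ ℝ and every integer N ≥ 1, the partial products satisfy the normalization ∑_{k=0}^{2^N − 1} ∏_{j=1}^{N} M((ξ + k)/2^j) = 1. -/
open Finset

/-- Shifting `x` by `2 ^ N` does not change the product of the first `N` dyadic dilates of a
`1`-periodic function. -/
theorem prod_dyadic_add_two_pow {M : ℝ → ℝ} (hM : Function.Periodic M 1) (N : ℕ) (x : ℝ) :
    ∏ j ∈ Finset.range N, M ((x + 2 ^ N) / 2 ^ (j + 1)) =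
      ∏ j ∈ Finset.range N, M (x / 2 ^ (j + 1)) := by
  refine Finset.prod_congr rfl fun j hj => ?_
  obtain ⟨d, rfl⟩ := Nat.exists_eq_add_of_le (Nat.succ_le_of_lt (Finset.mem_range.mp hj))
  have h : (x + 2 ^ (j.succ + d)) / 2 ^ (j + 1) = x / 2 ^ (j + 1) + ((2 ^ d : ℕ) : ℝ) * 1 := by
    rw [Nat.succ_eq_add_one, pow_add]
    push_cast
    field_simp
  rw [h, hM.nat_mul (2 ^ d)]

theorem sum_prod_dyadic_eq_one {M : ℝ → ℝ} (hM : Function.Periodic M 1)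
    (hsum : ∀ x, M x + M (x + 1 / 2) = 1) (ξ : ℝ) (N : ℕ) :
    ∑ k ∈ Finset.range (2 ^ N), ∏ j ∈ Finset.range N, M ((ξ + (k : ℝ)) / 2 ^ (j + 1)) = 1 := by
  induction N with
  | zero => simp
  | succ N ih =>
    rw [pow_succ, mul_two, Finset.sum_range_add, ← Finset.sum_add_distrib, ← ih]
    refine Finset.sum_congr rfl fun k _ => ?_
    have hcast : ξ + ((2 ^ N + k : ℕ) : ℝ) = ξ + k + 2 ^ N := by
      push_cast
      ring
    have hhalf : (ξ + k + 2 ^ N) / 2 ^ (N + 1) = (ξ + k) / 2 ^ (N + 1) + 1 / 2 := by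
      field_simp
      ring
    rw [hcast, Finset.prod_range_succ, Finset.prod_range_succ, prod_dyadic_add_two_pow hM,
      hhalf, ← mul_add, hsum, mul_one]

/-- For every `ξ ∈ ℝ` and every `N ≥ 1`,
`∑_{k=0}^{2^N − 1} ∏_{j=1}^{N} M((ξ + k)/2^j) = 1`. -/
theorem statement2 (M : ℝ → ℝ)
    (hM01 : ∀ ξ : ℝ, M ξ ∈ Set.Icc (0 : ℝ) 1)
    (hMmeas : Measurable M)
    (hMper : ∀ ξ : ℝ, M (ξ + 1) = M ξ)
    (hMsum : ∀ ξ : ℝ, M ξ + M (ξ + 1 / 2) = 1)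
    (hM0 : M 0 = 1) :
    ∀ (ξ : ℝ) (N : ℕ), 1 ≤ N →
      ∑ k ∈ Finset.range (2 ^ N), ∏ j ∈ Finset.range N, M ((ξ + (k : ℝ)) / 2 ^ (j + 1)) = 1 := by
  exact fun ξ N _ => sum_prod_dyadic_eq_one hMper hMsum ξ N
end

section
/- For every ξ ∈ ℝ and every integer N ≥ 0, ∑_{k=−2^N}^{2^N − 1} P^N_ξ(k) = 1; that is, P^N_ξ defines a probability measure on the integers −2^N ≤ k < 2^N. -/
open Finset

/-- If `M` is `1`-periodic and `M ξ + M (ξ + 1 / 2) = 1`, then the dyadic products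
`∏_{j=1}^{n} M (x / 2^j)` sum to one over any `2^n` consecutive unit translates of `x`. -/
theorem sum_range_prod_dyadic_eq_one {M : ℝ → ℝ} (hMper : Function.Periodic M 1)
    (hMsum : ∀ ξ : ℝ, M ξ + M (ξ + 1 / 2) = 1) (n : ℕ) (x : ℝ) :
    ∑ i ∈ Finset.range (2 ^ n),
      ∏ j ∈ Finset.range n, M ((x + (i : ℝ)) / 2 ^ (j + 1)) = 1 := by
  induction n with
  | zero => simp
  | succ n ih =>
    rw [pow_succ, mul_two, Finset.sum_range_add, ← Finset.sum_add_distrib, ← ih]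
    refine Finset.sum_congr rfl fun i _ => ?_
    have hshift : ∏ j ∈ Finset.range n, M ((x + ((2 ^ n + i : ℕ) : ℝ)) / 2 ^ (j + 1)) =
        ∏ j ∈ Finset.range n, M ((x + (i : ℝ)) / 2 ^ (j + 1)) := by
      refine Finset.prod_congr rfl fun j hj => ?_
      obtain ⟨d, rfl⟩ := Nat.exists_eq_add_of_lt (Finset.mem_range.mp hj)
      rw [← hMper.nat_mul (2 ^ d) ((x + (i : ℝ)) / 2 ^ (j + 1))]
      congr 1
      push_cast
      field_simp
      ring
    have hhalf : (x + ((2 ^ n + i : ℕ) : ℝ)) / 2 ^ (n + 1) =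
        (x + (i : ℝ)) / 2 ^ (n + 1) + 1 / 2 := by
      push_cast
      field_simp
      ring
    rw [Finset.prod_range_succ, Finset.prod_range_succ, hshift, hhalf, ← mul_add, hMsum, mul_one]

/-- For every `ξ ∈ ℝ` and every `N ≥ 0`,
`∑_{k=−2^N}^{2^N − 1} P^N_ξ(k) = 1`, where
`P^N_ξ(k) = ∏_{j=1}^{N+1} M((ξ + k)/2^j)`. -/
theorem statement3 (M : ℝ → ℝ)
    (hM01 : ∀ ξ : ℝ, M ξ ∈ Set.Icc (0 : ℝ) 1)
    (hMmeas : Measurable M)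
    (hMper : ∀ ξ : ℝ, M (ξ + 1) = M ξ)
    (hMsum : ∀ ξ : ℝ, M ξ + M (ξ + 1 / 2) = 1)
    (hM0 : M 0 = 1) :
    ∀ (ξ : ℝ) (N : ℕ),
      ∑ k ∈ Finset.Ico (-(2 ^ N) : ℤ) (2 ^ N),
        ∏ j ∈ Finset.range (N + 1), M ((ξ + (k : ℝ)) / 2 ^ (j + 1)) = 1 := by
  intro ξ N
  rw [← sum_range_prod_dyadic_eq_one hMper hMsum (N + 1) (ξ - 2 ^ N)]
  symm
  refine Finset.sum_bij (fun i _ => (i : ℤ) - 2 ^ N) ?_ ?_ ?_ ?_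
  · intro i hi
    have hlt : (i : ℤ) < 2 ^ (N + 1) := by exact_mod_cast Finset.mem_range.mp hi
    rw [pow_succ] at hlt
    rw [Finset.mem_Ico]
    constructor <;> linarith [Int.natCast_nonneg i]
  · intro i _ i' _ h
    simpa using h
  · intro k hk
    obtain ⟨hl, hr⟩ := Finset.mem_Ico.mp hk
    refine ⟨(k + 2 ^ N).toNat, ?_, ?_⟩
    · rw [Finset.mem_range, Int.toNat_lt (by linarith)]
      push_cast
      rw [pow_succ]
      linarith
    · rw [Int.toNat_of_nonneg (by linarith)]
      ring
  · intro i _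
    refine Finset.prod_congr rfl fun j _ => ?_
    congr 2
    push_cast
    ring
end

section
/- Let f : ℝ → ℝ be a Lebesgue-measurable function, and let L = { ξ ∈ [0,1) : for every integer k ≥ 0, lim_{j→∞} f((ξ + k)/2^j) = 1 }. Then the Lebesgue measure of L is either 0 or 1. -/
open MeasureTheory Filter Topology

/-- The property of converging along the dyadic contractions of `x` is invariant under halving. -/
lemma tendsto_div_two_pow_iff_double (f : ℝ → ℝ) (x : ℝ) (l : Filter ℝ) :
    Tendsto (fun j : ℕ => f (2 * x / 2 ^ j)) atTop l ↔
      Tendsto (fun j : ℕ => f (x / 2 ^ j)) atTop l := by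
  rw [← tendsto_add_atTop_iff_nat 1]
  have h (j : ℕ) : 2 * x / 2 ^ (j + 1) = x / 2 ^ j := by
    rw [pow_succ']
    exact mul_div_mul_left _ _ two_ne_zero
  simp only [h]

/-- A measurable subset of `[0, 1)` that contains every preimage of its points under the
doubling map has measure zero or one. -/
lemma volume_eq_zero_or_one_of_fract_two_mul_mem {L : Set ℝ} (hLm : MeasurableSet L)
    (hL : L ⊆ Set.Ico 0 1)
    (h : ∀ x ∈ Set.Ico (0 : ℝ) 1, Int.fract (2 * x) ∈ L → x ∈ L) :
    volume L = 0 ∨ volume L = 1 := by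
  let S : Set (AddCircle (1 : ℝ)) := {y | (AddCircle.equivIco 1 0 y : ℝ) ∈ L}
  have hrep (x : ℝ) : (x : AddCircle (1 : ℝ)) ∈ S ↔ Int.fract x ∈ L := by
    simp [S, AddCircle.coe_equivIco_mk_apply]
  have hSm : MeasurableSet S :=
    (measurable_subtype_coe.comp (AddCircle.measurableEquivIco (1 : ℝ) 0).measurable) hLm
  have hvol : volume S = volume L := by
    rw [← (AddCircle.measurePreserving_mk (1 : ℝ) 0).measure_preimage hSm.nullMeasurableSet,
      ← Measure.restrict_congr_set (Ico_ae_eq_Ioc (μ := volume)),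
      Measure.restrict_apply' measurableSet_Ico, zero_add]
    congr 1
    ext x
    simp only [Set.mem_inter_iff, Set.mem_preimage, hrep]
    constructor
    · rintro ⟨hx, hx'⟩
      rwa [Int.fract_eq_self.2 hx'] at hx
    · intro hx
      exact ⟨by rwa [Int.fract_eq_self.2 (hL hx)], hL hx⟩
  have hsub : (fun y : AddCircle (1 : ℝ) => 2 • y) ⁻¹' S ⊆ S := by
    intro y hy
    obtain ⟨x, hx, rfl⟩ : ∃ x ∈ Set.Ico (0 : ℝ) 1, (x : AddCircle (1 : ℝ)) = y :=
      ⟨AddCircle.equivIco 1 0 y, by simpa using (AddCircle.equivIco 1 0 y).2,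
        (AddCircle.equivIco 1 0).symm_apply_apply y⟩
    rw [Set.mem_preimage, ← AddCircle.coe_nsmul, hrep, nsmul_eq_mul, Nat.cast_two] at hy
    rw [hrep, Int.fract_eq_self.2 hx]
    exact h x hx hy
  rw [← hvol]
  rcases (AddCircle.ergodic_nsmul (T := (1 : ℝ)) one_lt_two).ae_empty_or_univ_of_preimage_ae_le
    hSm.nullMeasurableSet hsub.eventuallyLE with h0 | h1
  · exact Or.inl (by rw [measure_congr h0, measure_empty])
  · exact Or.inr (by rw [measure_congr h1, AddCircle.measure_univ, ENNReal.ofReal_one])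

/-- zero–one law: for a Lebesgue-measurable `f : ℝ → ℝ`, the set
`L = {ξ ∈ [0,1) : ∀ k ≥ 0, lim_{j→∞} f((ξ+k)/2^j) = 1}` has Lebesgue measure 0 or 1. -/
theorem statement4 (f : ℝ → ℝ) (hf : Measurable f)
    (L : Set ℝ)
    (hL : L = {ξ : ℝ | ξ ∈ Set.Ico (0 : ℝ) 1 ∧
      ∀ k : ℕ, Tendsto (fun j : ℕ => f ((ξ + (k : ℝ)) / 2 ^ j)) atTop (𝓝 1)}) :
    volume L = 0 ∨ volume L = 1 := by
  refine volume_eq_zero_or_one_of_fract_two_mul_mem ?_ (hL ▸ fun x hx => hx.1) ?_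
  · rw [hL, Set.ofPred_and, Set.ofPred_forall]
    refine measurableSet_Ico.inter (MeasurableSet.iInter fun k => ?_)
    exact measurableSet_tendsto (𝓝 1) fun j => by fun_prop
  · intro x hx hfr
    rw [hL] at hfr ⊢
    refine ⟨hx, fun k => ?_⟩
    rw [← tendsto_div_two_pow_iff_double]
    obtain ⟨n, hn⟩ := Int.eq_ofNat_of_zero_le (Int.floor_nonneg.2 (by linarith [hx.1] : 0 ≤ 2 * x))
    have hcast : (⌊2 * x⌋ : ℝ) = n := by rw [hn]; simp
    have heq : Int.fract (2 * x) + ((n + 2 * k : ℕ) : ℝ) = 2 * (x + k) := by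
      rw [Int.fract, hcast]
      push_cast
      ring
    simpa only [heq] using hfr.2 (n + 2 * k)
end

section
/- Define F(θ) = ∏_{j=1}^{∞} M(θ/2^j) for θ ∈ ℝ (the infinite product exists as the limit of the nonincreasing partial products). Then the following are equivalent: (1) lim_{j→∞} F(θ/2^j) = 1 for almost every θ ∈ ℝ; (2) there exist measurable sets L⁺ ⊂ [0,1) and L⁻ ⊂ [0,1), each of positive Lebesgue measure, such that for every ξ ∈ L⁺ and every integer k ≥ 0, lim_{j→∞} F((ξ + k)/2^j) = 1, and for every ξ ∈ L⁻ and every integer k ≤ −1, lim_{j→∞} F((ξ + k)/2^j) = 1. -/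
open MeasureTheory Filter Topology Finset

open scoped Pointwise in
/-- A measurable set of reals that is stable under halving and contains all translates `L + k`,
`k : ℕ`, of a set `L ⊆ [0, 1]` of positive measure contains almost every nonnegative real. -/
theorem ae_mem_of_nat_translates_subset {G L : Set ℝ} (hG : MeasurableSet G)
    (hG2 : ∀ x ∈ G, x / 2 ∈ G) (hL : L ⊆ Set.Icc 0 1) (hL0 : volume L ≠ 0)
    (hLG : ∀ ξ ∈ L, ∀ k : ℕ, ξ + k ∈ G) : ∀ᵐ x : ℝ, 0 ≤ x → x ∈ G := by
  have hGpow : ∀ (n : ℕ), ∀ x ∈ G, (2 ^ n : ℝ)⁻¹ * x ∈ G := by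
    intro n
    induction n with
    | zero => simp
    | succ n ih =>
      intro x hx
      convert hG2 _ (ih x hx) using 1
      rw [pow_succ]
      field_simp
  filter_upwards [Besicovitch.ae_tendsto_measure_inter_div_of_measurableSet volume hG] with x hx hx0
  by_contra hxG
  have hr : Tendsto (fun n : ℕ => (2 ^ n : ℝ)⁻¹) atTop (𝓝[>] 0) :=
    tendsto_inv_atTop_nhdsGT_zero.comp (tendsto_pow_atTop_atTop_of_one_lt one_lt_two)
  have hlim := hx.comp hr
  rw [Set.indicator_of_notMem hxG] at hlim
  have hbound : ∀ n : ℕ, volume L / 2 ≤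
      volume (G ∩ Metric.closedBall x (2 ^ n : ℝ)⁻¹) /
        volume (Metric.closedBall x (2 ^ n : ℝ)⁻¹) := by
    intro n
    have hpos : (0 : ℝ) < (2 ^ n : ℝ)⁻¹ := by positivity
    set k := ⌊(2 ^ n : ℝ) * x⌋₊
    have hk : (k : ℝ) ≤ 2 ^ n * x := Nat.floor_le (by positivity)
    have hk' : 2 ^ n * x < k + 1 := Nat.lt_floor_add_one _
    have hsub : (2 ^ n : ℝ)⁻¹ • ((k : ℝ) +ᵥ L) ⊆ G ∩ Metric.closedBall x (2 ^ n : ℝ)⁻¹ := by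
      rintro _ ⟨_, ⟨ξ, hξ, rfl⟩, rfl⟩
      obtain ⟨h0, h1⟩ := hL hξ
      simp only [vadd_eq_add, smul_eq_mul]
      refine ⟨hGpow n _ (add_comm ξ (k : ℝ) ▸ hLG ξ hξ k), ?_⟩
      have hdist : (2 ^ n : ℝ)⁻¹ * (k + ξ) - x = (2 ^ n : ℝ)⁻¹ * (k + ξ - 2 ^ n * x) := by
        field_simp
      rw [Metric.mem_closedBall, Real.dist_eq, hdist, abs_mul, abs_of_pos hpos]
      exact mul_le_of_le_one_right hpos.le (abs_le.2 ⟨by linarith, by linarith⟩)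
    have hvol := measure_mono (μ := volume) hsub
    rw [Measure.addHaar_smul, measure_vadd, Module.finrank_self, pow_one, abs_of_pos hpos] at hvol
    have hc : ENNReal.ofReal (2 ^ n : ℝ)⁻¹ ≠ 0 := by simp
    rw [Real.volume_closedBall, mul_comm 2, ENNReal.ofReal_mul hpos.le, ENNReal.ofReal_ofNat,
      ← ENNReal.mul_div_mul_left (volume L) 2 hc ENNReal.ofReal_ne_top]
    exact ENNReal.div_le_div_right hvol _
  have hle : volume L / 2 ≤ 0 := ge_of_tendsto' hlim hbound
  simp [hL0] at hle

/-- with `F(θ) = ∏_{j=1}^∞ M(θ/2^j)` (limit of the nonincreasing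
partial products), the condition `lim_{j→∞} F(θ/2^j) = 1` for a.e. `θ ∈ ℝ`
is equivalent to the existence of measurable sets `L⁺, L⁻ ⊆ [0,1)` of positive
measure on which the corresponding dyadic limits along `k ≥ 0` (resp. `k ≤ −1`)
are all equal to `1`. -/
theorem statement5 (M : ℝ → ℝ)
    (hM01 : ∀ ξ : ℝ, M ξ ∈ Set.Icc (0 : ℝ) 1)
    (hMmeas : Measurable M)
    (hMper : ∀ ξ : ℝ, M (ξ + 1) = M ξ)
    (hMsum : ∀ ξ : ℝ, M ξ + M (ξ + 1 / 2) = 1)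
    (hM0 : M 0 = 1)
    (F : ℝ → ℝ)
    (hF : ∀ θ : ℝ, Tendsto (fun N : ℕ => ∏ j ∈ Finset.range N, M (θ / 2 ^ (j + 1)))
      atTop (𝓝 (F θ))) :
    (∀ᵐ θ : ℝ ∂volume, Tendsto (fun j : ℕ => F (θ / 2 ^ j)) atTop (𝓝 1)) ↔
    (∃ Lp Lm : Set ℝ, MeasurableSet Lp ∧ MeasurableSet Lm ∧
      Lp ⊆ Set.Ico (0 : ℝ) 1 ∧ Lm ⊆ Set.Ico (0 : ℝ) 1 ∧
      0 < volume Lp ∧ 0 < volume Lm ∧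
      (∀ ξ ∈ Lp, ∀ k : ℤ, 0 ≤ k →
        Tendsto (fun j : ℕ => F ((ξ + (k : ℝ)) / 2 ^ j)) atTop (𝓝 1)) ∧
      (∀ ξ ∈ Lm, ∀ k : ℤ, k ≤ -1 →
        Tendsto (fun j : ℕ => F ((ξ + (k : ℝ)) / 2 ^ j)) atTop (𝓝 1))) := by
  have hFmeas : Measurable F := by
    refine measurable_of_tendsto_metrizable
      (f := fun (N : ℕ) θ => ∏ j ∈ Finset.range N, M (θ / 2 ^ (j + 1))) ?_ (tendsto_pi_nhds.2 hF)
    exact fun N => Finset.measurable_fun_prod _ fun j _ => hMmeas.comp (measurable_id.div_const _)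
  set G : Set ℝ := {θ | Tendsto (fun j : ℕ => F (θ / 2 ^ j)) atTop (𝓝 1)}
  have hG : MeasurableSet G :=
    measurableSet_tendsto _ fun j => hFmeas.comp (measurable_id.div_const _)
  have hG2 : ∀ x ∈ G, x / 2 ∈ G := by
    intro x hx
    refine ((tendsto_add_atTop_iff_nat 1).2 hx).congr fun j => ?_
    rw [pow_succ', div_div]
  constructor
  · intro h
    have hall : ∀ᵐ ξ : ℝ, ∀ k : ℤ, ξ + k ∈ G :=
      ae_all_iff.2 fun k => (measurePreserving_add_right volume (k : ℝ)).quasiMeasurePreserving.ae h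
    set L : Set ℝ := Set.Ico 0 1 ∩ {ξ | ∀ k : ℤ, ξ + k ∈ G}
    have hLmeas : MeasurableSet L := by
      refine measurableSet_Ico.inter ?_
      rw [Set.ofPred_forall]
      exact MeasurableSet.iInter fun k => (measurable_id.add_const (k : ℝ)) hG
    have hL : 0 < volume L := by
      rw [measure_inter_conull hall]
      simp
    exact ⟨L, L, hLmeas, hLmeas, Set.inter_subset_left, Set.inter_subset_left, hL, hL,
      fun ξ hξ k _ => hξ.2 k, fun ξ hξ k _ => hξ.2 k⟩
  · rintro ⟨Lp, Lm, -, -, hLp, hLm, hLp0, hLm0, hp, hm⟩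
    have hpos : ∀ᵐ x : ℝ, 0 ≤ x → x ∈ G :=
      ae_mem_of_nat_translates_subset hG hG2 (hLp.trans Set.Ico_subset_Icc_self) hLp0.ne'
        fun ξ hξ k => Int.cast_natCast (R := ℝ) k ▸ hp ξ hξ k (by positivity)
    have hneg : ∀ᵐ x : ℝ, 0 ≤ x → -x ∈ G := by
      refine ae_mem_of_nat_translates_subset (G := Neg.neg ⁻¹' G) (L := (fun x => 1 - x) ⁻¹' Lm)
        (measurable_neg hG) (fun x hx => ?_) (fun x hx => ?_) ?_ fun ξ hξ k => ?_
      · simpa [neg_div] using hG2 _ hx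
      · obtain ⟨h0, h1⟩ := hLm hx
        constructor <;> linarith
      · rw [(Measure.measurePreserving_sub_left volume (1 : ℝ)).measure_preimage_emb
          (MeasurableEquiv.subLeft (1 : ℝ)).measurableEmbedding]
        exact hLm0.ne'
      · have h := hm _ hξ (-k - 1) (by lia)
        have heq : 1 - ξ + ((-k - 1 : ℤ) : ℝ) = -(ξ + k) := by
          push_cast
          ring
        rwa [heq] at h
    filter_upwards [hpos, (Measure.measurePreserving_neg volume).quasiMeasurePreserving.ae hneg]
      with x hx hx'
    rcases le_total 0 x with h | h
    · exact hx h
    · exact neg_neg x ▸ hx' (neg_nonneg.2 h)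
end

section
/- For every ξ ∈ ℝ, all integers k, ℓ ∈ ℤ, and every integer N ≥ 0, the infinite products satisfy the factorization identity P_ξ(k + 2^{N+1}ℓ) = P^N_ξ(k) · P_{ξ'}(ℓ), where ξ' = (ξ + k)/2^{N+1}. -/
open MeasureTheory Filter Topology Finset

/-- factorization identity
`P_ξ(k + 2^{N+1}ℓ) = P^N_ξ(k) · P_{ξ'}(ℓ)` with `ξ' = (ξ+k)/2^{N+1}`, where
`P^N_ξ(k) = ∏_{j=1}^{N+1} M((ξ+k)/2^j)` and `P_ξ(k)` is the limit of these
nonincreasing partial products. -/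
theorem statement6 (M : ℝ → ℝ)
    (hM01 : ∀ ξ : ℝ, M ξ ∈ Set.Icc (0 : ℝ) 1)
    (hMmeas : Measurable M)
    (hMper : ∀ ξ : ℝ, M (ξ + 1) = M ξ)
    (hMsum : ∀ ξ : ℝ, M ξ + M (ξ + 1 / 2) = 1)
    (hM0 : M 0 = 1)
    (P : ℝ → ℤ → ℝ)
    (hP : ∀ (ξ : ℝ) (k : ℤ),
      Filter.Tendsto (fun N : ℕ => ∏ j ∈ Finset.range (N + 1), M ((ξ + (k : ℝ)) / 2 ^ (j + 1)))
        atTop (𝓝 (P ξ k))) :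
    ∀ (ξ : ℝ) (k ℓ : ℤ) (N : ℕ),
      P ξ (k + 2 ^ (N + 1) * ℓ) =
        (∏ j ∈ Finset.range (N + 1), M ((ξ + (k : ℝ)) / 2 ^ (j + 1))) *
          P ((ξ + (k : ℝ)) / 2 ^ (N + 1)) ℓ := by
  intro ξ k ℓ N
  refine tendsto_nhds_unique
    ((hP ξ (k + 2 ^ (N + 1) * ℓ)).comp (tendsto_add_atTop_nat (N + 1))) ?_
  refine ((hP ((ξ + (k : ℝ)) / 2 ^ (N + 1)) ℓ).const_mul
    (∏ j ∈ Finset.range (N + 1), M ((ξ + (k : ℝ)) / 2 ^ (j + 1)))).congr fun n => ?_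
  rw [Function.comp_apply, show n + (N + 1) + 1 = (N + 1) + (n + 1) by ring,
    Finset.prod_range_add _ (N + 1) (n + 1)]
  symm
  congr 1
  · refine Finset.prod_congr rfl fun j hj => ?_
    obtain ⟨d, rfl⟩ := Nat.exists_eq_add_of_le (Nat.lt_succ_iff.mp (Finset.mem_range.mp hj))
    have hper : Function.Periodic M 1 := hMper
    rw [← hper.int_mul (2 ^ d * ℓ) ((ξ + (k : ℝ)) / 2 ^ (j + 1))]
    congr 1
    push_cast
    field_simp
    ring
  · refine Finset.prod_congr rfl fun i _ => ?_
    congr 1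
    push_cast
    field_simp
    ring
end

section
/- Suppose condition (C) holds: there exists δ > 0 such that for almost every ξ ∈ [0,1] there is an integer k(ξ) ∈ ℤ with P_ξ(k(ξ)) ≥ δ. Then ∑_{k∈ℤ} P_ξ(k) = 1 for almost every ξ ∈ [0,1]. -/
open MeasureTheory Filter Topology Finset

/-- The partial product `∏_{j=1}^{N} M(x / 2^j)`. -/
noncomputable def dyadicProd (M : ℝ → ℝ) (N : ℕ) (x : ℝ) : ℝ :=
  ∏ j ∈ range N, M (x / 2 ^ (j + 1))

section dyadicProd

variable {M : ℝ → ℝ}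

lemma dyadicProd_nonneg (hM : ∀ ξ, 0 ≤ M ξ) (N : ℕ) (x : ℝ) : 0 ≤ dyadicProd M N x :=
  prod_nonneg fun _ _ => hM _

lemma dyadicProd_succ (N : ℕ) (x : ℝ) :
    dyadicProd M (N + 1) x = dyadicProd M N x * M (x / 2 ^ (N + 1)) :=
  prod_range_succ _ _

lemma dyadicProd_add (N n : ℕ) (x : ℝ) :
    dyadicProd M (N + n) x = dyadicProd M N x * dyadicProd M n (x / 2 ^ N) := by
  unfold dyadicProd
  rw [prod_range_add]
  congr 1
  refine prod_congr rfl fun j _ => ?_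
  rw [div_div, ← pow_add, add_assoc]

lemma dyadicProd_add_two_pow_mul (hM : Function.Periodic M 1) (N : ℕ) (x : ℝ) (m : ℤ) :
    dyadicProd M N (x + 2 ^ N * m) = dyadicProd M N x := by
  refine prod_congr rfl fun j hj => ?_
  obtain ⟨d, rfl⟩ := Nat.exists_eq_add_of_lt (mem_range.1 hj)
  have h : (x + 2 ^ (j + d + 1) * m) / 2 ^ (j + 1)
      = x / 2 ^ (j + 1) + ((2 ^ d * m : ℤ) : ℝ) * 1 := by
    push_cast
    field_simp
    ring
  rw [h, hM.int_mul]

lemma dyadicProd_add_emod (hM : Function.Periodic M 1) (N : ℕ) (x : ℝ) (k : ℤ) :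
    dyadicProd M N (x + ((k % 2 ^ N : ℤ) : ℝ)) = dyadicProd M N (x + k) := by
  rw [← dyadicProd_add_two_pow_mul hM N _ (k / 2 ^ N)]
  congr 1
  have h : ((k % 2 ^ N + 2 ^ N * (k / 2 ^ N) : ℤ) : ℝ) = k := by rw [Int.emod_add_mul_ediv]
  push_cast at h ⊢
  linarith

lemma sum_range_dyadicProd (hM : Function.Periodic M 1) (hsum : ∀ ξ, M ξ + M (ξ + 1 / 2) = 1)
    (N : ℕ) (x : ℝ) : ∑ r ∈ range (2 ^ N), dyadicProd M N (x + r) = 1 := by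
  induction N with
  | zero => simp [dyadicProd]
  | succ N ih =>
    rw [pow_succ, mul_two, sum_range_add, ← sum_add_distrib, ← ih]
    refine sum_congr rfl fun r _ => ?_
    have h₁ : x + ((2 ^ N + r : ℕ) : ℝ) = x + r + 2 ^ N * (1 : ℤ) := by push_cast; ring
    have h₂ : (x + r + 2 ^ N * (1 : ℤ)) / 2 ^ (N + 1) = (x + r) / 2 ^ (N + 1) + 1 / 2 := by
      push_cast; field_simp; ring
    rw [h₁, dyadicProd_succ, dyadicProd_succ, dyadicProd_add_two_pow_mul hM, ← mul_add, h₂, hsum,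
      mul_one]

lemma sum_Ico_dyadicProd (hM : Function.Periodic M 1) (hsum : ∀ ξ, M ξ + M (ξ + 1 / 2) = 1)
    (N : ℕ) (x : ℝ) : ∑ r ∈ Ico (0 : ℤ) (2 ^ N), dyadicProd M N (x + r) = 1 := by
  rw [← sum_range_dyadicProd hM hsum N x]
  symm
  refine sum_bij (fun r _ => (r : ℤ)) ?_ ?_ ?_ ?_
  · intro r hr
    have := mem_range.1 hr
    exact mem_Ico.2 ⟨by positivity, by exact_mod_cast this⟩
  · intro a _ b _ h
    exact_mod_cast h
  · intro b hb
    obtain ⟨h0, h1⟩ := mem_Ico.1 hb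
    lift b to ℕ using h0
    exact ⟨b, mem_range.2 (by exact_mod_cast h1), rfl⟩
  · intro r _
    simp

lemma emod_two_pow_mem_Ico (N : ℕ) (k : ℤ) : k % 2 ^ N ∈ Ico (0 : ℤ) (2 ^ N) :=
  mem_Ico.2 ⟨Int.emod_nonneg _ (by positivity), Int.emod_lt_of_pos _ (by positivity)⟩

/-- Distinct integers of a finite set are eventually distinct modulo `2 ^ N`. -/
lemma eventually_injOn_emod_two_pow (K : Finset ℤ) :
    ∀ᶠ N : ℕ in atTop, Set.InjOn (fun k : ℤ => k % 2 ^ N) K := by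
  have hlarge : ∀ᶠ N : ℕ in atTop, ∀ a ∈ K, ∀ b ∈ K, |a - b| < 2 ^ N := by
    refine (Finset.eventually_all K).2 fun a _ => (Finset.eventually_all K).2 fun b _ => ?_
    exact (tendsto_pow_atTop_atTop_of_one_lt (by norm_num : (1 : ℤ) < 2)).eventually_gt_atTop _
  filter_upwards [hlarge] with N hN a ha b hb hab
  have hdvd : (2 ^ N : ℤ) ∣ a - b := Int.ModEq.dvd (Int.ModEq.symm hab)
  exact sub_eq_zero.1 (Int.eq_zero_of_abs_lt_dvd hdvd (hN a ha b hb))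

lemma eventually_sum_dyadicProd_le_one (h0 : ∀ ξ, 0 ≤ M ξ) (hM : Function.Periodic M 1)
    (hsum : ∀ ξ, M ξ + M (ξ + 1 / 2) = 1) (K : Finset ℤ) (x : ℝ) :
    ∀ᶠ N : ℕ in atTop, ∑ k ∈ K, dyadicProd M N (x + k) ≤ 1 := by
  filter_upwards [eventually_injOn_emod_two_pow K] with N hN
  calc ∑ k ∈ K, dyadicProd M N (x + k)
      = ∑ r ∈ K.image (fun k : ℤ => k % 2 ^ N), dyadicProd M N (x + r) := by
        rw [sum_image hN]
        exact sum_congr rfl fun k _ => (dyadicProd_add_emod hM N x k).symm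
    _ ≤ ∑ r ∈ Ico (0 : ℤ) (2 ^ N), dyadicProd M N (x + r) :=
        sum_le_sum_of_subset_of_nonneg
          (image_subset_iff.2 fun k _ => emod_two_pow_mem_Ico N k)
          fun _ _ _ => dyadicProd_nonneg h0 _ _
    _ = 1 := sum_Ico_dyadicProd hM hsum N x

/-- The residues modulo `2 ^ N` avoided by `K` carry at least the mass not carried by `K`. -/
lemma one_sub_sum_dyadicProd_le (h0 : ∀ ξ, 0 ≤ M ξ) (hM : Function.Periodic M 1)
    (hsum : ∀ ξ, M ξ + M (ξ + 1 / 2) = 1) (K : Finset ℤ) (N : ℕ) (x : ℝ) :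
    1 - ∑ k ∈ K, dyadicProd M N (x + k) ≤
      ∑ r ∈ Ico (0 : ℤ) (2 ^ N) \ K.image (fun k : ℤ => k % 2 ^ N), dyadicProd M N (x + r) := by
  have hsub : K.image (fun k : ℤ => k % 2 ^ N) ⊆ Ico (0 : ℤ) (2 ^ N) :=
    image_subset_iff.2 fun k _ => emod_two_pow_mem_Ico N k
  have htot := sum_sdiff (f := fun r : ℤ => dyadicProd M N (x + r)) hsub
  rw [sum_Ico_dyadicProd hM hsum] at htot
  have himg : ∑ r ∈ K.image (fun k : ℤ => k % 2 ^ N), dyadicProd M N (x + r)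
      ≤ ∑ k ∈ K, dyadicProd M N (x + k) := by
    have := sum_image_le_of_nonneg (s := K) (g := fun k : ℤ => k % 2 ^ N)
      (f := fun r : ℤ => dyadicProd M N (x + r)) (fun _ _ => dyadicProd_nonneg h0 _ _)
    refine this.trans_eq (sum_congr rfl fun k _ => dyadicProd_add_emod hM N x k)
  linarith

end dyadicProd

section dyadicLimit

variable {M : ℝ → ℝ} {P : ℝ → ℤ → ℝ}

lemma dyadicLimit_nonneg (h0 : ∀ ξ, 0 ≤ M ξ)
    (hP : ∀ ξ (k : ℤ), Tendsto (fun N => dyadicProd M N (ξ + k)) atTop (𝓝 (P ξ k)))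
    (ξ : ℝ) (k : ℤ) : 0 ≤ P ξ k :=
  ge_of_tendsto' (hP ξ k) fun _ => dyadicProd_nonneg h0 _ _

lemma dyadicLimit_add_two_pow_mul (hM : Function.Periodic M 1)
    (hP : ∀ ξ (k : ℤ), Tendsto (fun N => dyadicProd M N (ξ + k)) atTop (𝓝 (P ξ k)))
    (N : ℕ) (ξ : ℝ) (r m : ℤ) :
    P ξ (r + 2 ^ N * m) = dyadicProd M N (ξ + r) * P ((ξ + r) / 2 ^ N) m := by
  refine tendsto_nhds_unique ((tendsto_add_atTop_iff_nat N).2 (hP ξ (r + 2 ^ N * m))) ?_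
  refine ((hP ((ξ + r) / 2 ^ N) m).const_mul _).congr fun n => ?_
  have h₁ : ξ + ((r + 2 ^ N * m : ℤ) : ℝ) = ξ + r + 2 ^ N * m := by push_cast; ring
  have h₂ : (ξ + r + 2 ^ N * m) / 2 ^ N = (ξ + r) / 2 ^ N + m := by field_simp
  rw [add_comm n N, dyadicProd_add, h₁, dyadicProd_add_two_pow_mul hM, h₂]

lemma sum_dyadicLimit_le_one (h0 : ∀ ξ, 0 ≤ M ξ) (hM : Function.Periodic M 1)
    (hsum : ∀ ξ, M ξ + M (ξ + 1 / 2) = 1)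
    (hP : ∀ ξ (k : ℤ), Tendsto (fun N => dyadicProd M N (ξ + k)) atTop (𝓝 (P ξ k)))
    (K : Finset ℤ) (ξ : ℝ) : ∑ k ∈ K, P ξ k ≤ 1 :=
  le_of_tendsto (tendsto_finsetSum K fun k _ => hP ξ k)
    (eventually_sum_dyadicProd_le_one h0 hM hsum K ξ)

lemma sum_add_mul_le_tsum_dyadicLimit (h0 : ∀ ξ, 0 ≤ M ξ) (hM : Function.Periodic M 1)
    (hsum : ∀ ξ, M ξ + M (ξ + 1 / 2) = 1)
    (hP : ∀ ξ (k : ℤ), Tendsto (fun N => dyadicProd M N (ξ + k)) atTop (𝓝 (P ξ k)))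
    {ξ δ : ℝ} (hδ : 0 ≤ δ) (hs : Summable (P ξ)) (N : ℕ)
    (hC : ∀ r ∈ Ico (0 : ℤ) (2 ^ N), ∃ m, δ ≤ P ((ξ + r) / 2 ^ N) m) (K : Finset ℤ) :
    ∑ k ∈ K, P ξ k + δ * (1 - ∑ k ∈ K, dyadicProd M N (ξ + k)) ≤ ∑' k, P ξ k := by
  choose! m hm using hC
  set A := Ico (0 : ℤ) (2 ^ N) \ K.image (fun k : ℤ => k % 2 ^ N)
  have hmod : ∀ r ∈ A, (r + 2 ^ N * m r) % 2 ^ N = r := fun r hr => by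
    obtain ⟨h₁, h₂⟩ := mem_Ico.1 (mem_sdiff.1 hr).1
    rw [Int.add_mul_emod_self_left, Int.emod_eq_of_lt h₁ h₂]
  have hinj : Set.InjOn (fun r => r + 2 ^ N * m r) A := fun a ha b hb hab => by
    rw [← hmod a ha, ← hmod b hb]
    exact congrArg (· % 2 ^ N) hab
  have hdisj : Disjoint K (A.image fun r => r + 2 ^ N * m r) := by
    rw [disjoint_right]
    intro k hk hkK
    obtain ⟨r, hr, rfl⟩ := mem_image.1 hk
    exact (mem_sdiff.1 hr).2 (mem_image.2 ⟨_, hkK, hmod r hr⟩)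
  have hA' : δ * (1 - ∑ k ∈ K, dyadicProd M N (ξ + k))
      ≤ ∑ k ∈ A.image (fun r => r + 2 ^ N * m r), P ξ k := by
    rw [sum_image hinj]
    calc δ * (1 - ∑ k ∈ K, dyadicProd M N (ξ + k))
        ≤ δ * ∑ r ∈ A, dyadicProd M N (ξ + r) :=
          mul_le_mul_of_nonneg_left (one_sub_sum_dyadicProd_le h0 hM hsum K N ξ) hδ
      _ = ∑ r ∈ A, dyadicProd M N (ξ + r) * δ := by rw [mul_comm, sum_mul]
      _ ≤ ∑ r ∈ A, P ξ (r + 2 ^ N * m r) := sum_le_sum fun r hr => by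
          rw [dyadicLimit_add_two_pow_mul hM hP]
          exact mul_le_mul_of_nonneg_left (hm r (mem_sdiff.1 hr).1) (dyadicProd_nonneg h0 _ _)
  calc _ ≤ ∑ k ∈ K, P ξ k + ∑ k ∈ A.image (fun r => r + 2 ^ N * m r), P ξ k := by gcongr
    _ = ∑ k ∈ K ∪ A.image (fun r => r + 2 ^ N * m r), P ξ k := (sum_union hdisj).symm
    _ ≤ ∑' k, P ξ k := hs.sum_le_tsum _ fun k _ => dyadicLimit_nonneg h0 hP ξ k

lemma tsum_dyadicLimit_eq_one (h0 : ∀ ξ, 0 ≤ M ξ) (hM : Function.Periodic M 1)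
    (hsum : ∀ ξ, M ξ + M (ξ + 1 / 2) = 1)
    (hP : ∀ ξ (k : ℤ), Tendsto (fun N => dyadicProd M N (ξ + k)) atTop (𝓝 (P ξ k)))
    {ξ δ : ℝ} (hδ : 0 < δ)
    (hC : ∀ N : ℕ, ∀ r ∈ Ico (0 : ℤ) (2 ^ N), ∃ m, δ ≤ P ((ξ + r) / 2 ^ N) m) :
    ∑' k, P ξ k = 1 := by
  have hle := fun K => sum_dyadicLimit_le_one h0 hM hsum hP K ξ
  have hs : Summable (P ξ) := summable_of_sum_le (dyadicLimit_nonneg h0 hP ξ) hle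
  have hK : ∀ K : Finset ℤ, ∑ k ∈ K, P ξ k + δ * (1 - ∑ k ∈ K, P ξ k) ≤ ∑' k, P ξ k := fun K =>
    le_of_tendsto
      ((((tendsto_finsetSum K fun k _ => hP ξ k).const_sub 1).const_mul δ).const_add _)
      (Eventually.of_forall fun N =>
        sum_add_mul_le_tsum_dyadicLimit h0 hM hsum hP hδ.le hs N (hC N) K)
  have hlim := le_of_tendsto'
    (Tendsto.add hs.hasSum ((Tendsto.const_sub 1 hs.hasSum).const_mul δ)) hK
  refine le_antisymm (hs.tsum_le_of_sum_le hle) ?_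
  have h : δ * (1 - ∑' k, P ξ k) ≤ 0 := by linarith
  linarith [nonpos_of_mul_nonpos_right h hδ]

end dyadicLimit

/-- A property holding almost everywhere on `[0, 1]` holds, for almost every `ξ ∈ [0, 1]`, at all
the points `(ξ + r) / 2 ^ N` with `0 ≤ r < 2 ^ N`. -/
lemma ae_forall_dyadic_of_ae {p : ℝ → Prop}
    (hp : ∀ᵐ ξ ∂(volume.restrict (Set.Icc (0 : ℝ) 1)), p ξ) :
    ∀ᵐ ξ ∂(volume.restrict (Set.Icc (0 : ℝ) 1)),
      ∀ N : ℕ, ∀ r ∈ Ico (0 : ℤ) (2 ^ N), p ((ξ + r) / 2 ^ N) := by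
  rw [ae_restrict_iff' measurableSet_Icc] at hp ⊢
  have hmap : ∀ (N : ℕ) (r : ℤ), ∀ᵐ ξ : ℝ, (ξ + r) / 2 ^ N ∈ Set.Icc (0 : ℝ) 1 →
      p ((ξ + r) / 2 ^ N) := fun N r => by
    have h₁ : ∀ᵐ y : ℝ, y / 2 ^ N ∈ Set.Icc (0 : ℝ) 1 → p (y / 2 ^ N) := by
      rw [ae_iff] at hp ⊢
      have h := Measure.addHaar_preimage_smul (volume : Measure ℝ)
        (r := ((2 : ℝ) ^ N)⁻¹) (by positivity) {a | ¬(a ∈ Set.Icc (0 : ℝ) 1 → p a)}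
      rw [hp, mul_zero] at h
      simpa only [Set.preimage_ofPred_eq, smul_eq_mul, inv_mul_eq_div] using h
    exact (measurePreserving_add_right volume (r : ℝ)).quasiMeasurePreserving.ae h₁
  filter_upwards [ae_all_iff.2 fun N => ae_all_iff.2 (hmap N)] with ξ h hξ N r hr
  obtain ⟨hr₀, hr₁⟩ := mem_Ico.1 hr
  have hr₀' : (0 : ℝ) ≤ r := by exact_mod_cast hr₀
  have hr₁' : (r : ℝ) + 1 ≤ 2 ^ N := by exact_mod_cast Int.add_one_le_iff.2 hr₁
  refine h N r ⟨div_nonneg (by linarith [hξ.1]) (by positivity), ?_⟩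
  rw [div_le_one (by positivity)]
  linarith [hξ.2]

/-- if condition (C) holds — there is `δ > 0` such that for a.e.
`ξ ∈ [0,1]` some integer `k(ξ)` has `P_ξ(k(ξ)) ≥ δ` — then
`∑_{k∈ℤ} P_ξ(k) = 1` for a.e. `ξ ∈ [0,1]`. -/
theorem statement7 (M : ℝ → ℝ)
    (hM01 : ∀ ξ : ℝ, M ξ ∈ Set.Icc (0 : ℝ) 1)
    (hMmeas : Measurable M)
    (hMper : ∀ ξ : ℝ, M (ξ + 1) = M ξ)
    (hMsum : ∀ ξ : ℝ, M ξ + M (ξ + 1 / 2) = 1)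
    (hM0 : M 0 = 1)
    (P : ℝ → ℤ → ℝ)
    (hP : ∀ (ξ : ℝ) (k : ℤ),
      Filter.Tendsto (fun N : ℕ => ∏ j ∈ Finset.range (N + 1), M ((ξ + (k : ℝ)) / 2 ^ (j + 1)))
        atTop (𝓝 (P ξ k)))
    (hC : ∃ δ > (0 : ℝ), ∀ᵐ ξ ∂(volume.restrict (Set.Icc (0 : ℝ) 1)), ∃ k : ℤ, δ ≤ P ξ k) :
    ∀ᵐ ξ ∂(volume.restrict (Set.Icc (0 : ℝ) 1)), ∑' k : ℤ, P ξ k = 1 := by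
  obtain ⟨δ, hδ, hC⟩ := hC
  have hP' : ∀ ξ (k : ℤ), Tendsto (fun N => dyadicProd M N (ξ + k)) atTop (𝓝 (P ξ k)) :=
    fun ξ k => (tendsto_add_atTop_iff_nat 1).1 (hP ξ k)
  filter_upwards [ae_forall_dyadic_of_ae hC] with ξ hξ
  exact tsum_dyadicLimit_eq_one (fun ξ => (hM01 ξ).1) hMper hMsum hP' hδ hξ
end

section
/- Suppose that for each k ∈ ℤ the map ξ ↦ P_ξ(k) is continuous on [0,1], and that ∑_{k∈ℤ} P_ξ(k) = 1 for every ξ ∈ [0,1]. Then there exist δ > 0 and a finite set of integers Z₀ ⊂ ℤ such that for every ξ ∈ [0,1] one has ∑_{k∈Z₀} P_ξ(k) ≥ δ; in particular, for every ξ ∈ [0,1] there is k(ξ) ∈ Z₀ with P_ξ(k(ξ)) ≥ δ / card(Z₀), so condition (C) holds with no exceptional set. -/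
open MeasureTheory Filter Topology Finset

/-- If a family of nonnegative functions is continuous on a compact set and its sum exceeds `c` at
every point, then a single finite partial sum exceeds `c` on the whole set. -/
theorem IsCompact.exists_finset_forall_lt_sum {X ι : Type*} [TopologicalSpace X] {K : Set X}
    (hK : IsCompact K) {f : X → ι → ℝ} {c : ℝ} (hf : ∀ i, ContinuousOn (fun x => f x i) K)
    (hnonneg : ∀ x i, 0 ≤ f x i) (hsummable : ∀ x ∈ K, Summable (f x))
    (hlt : ∀ x ∈ K, c < ∑' i, f x i) :
    ∃ Z : Finset ι, ∀ x ∈ K, c < ∑ i ∈ Z, f x i := by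
  classical
  suffices h : ∃ Z : Finset ι, ∀ x ∈ K, x ∈ K → c < ∑ i ∈ Z, f x i by
    obtain ⟨Z, hZ⟩ := h
    exact ⟨Z, fun x hx => hZ x hx hx⟩
  refine hK.induction_on (p := fun s => ∃ Z : Finset ι, ∀ x ∈ s, x ∈ K → c < ∑ i ∈ Z, f x i)
    ⟨∅, by simp⟩ (fun s t hst ⟨Z, hZ⟩ => ⟨Z, fun x hx => hZ x (hst hx)⟩) ?_ ?_
  · rintro s t ⟨Z, hZ⟩ ⟨W, hW⟩
    refine ⟨Z ∪ W, ?_⟩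
    rintro x (hx | hx) hxK
    · exact (hZ x hx hxK).trans_le
        (Finset.sum_le_sum_of_subset_of_nonneg Finset.subset_union_left fun i _ _ => hnonneg x i)
    · exact (hW x hx hxK).trans_le
        (Finset.sum_le_sum_of_subset_of_nonneg Finset.subset_union_right fun i _ _ => hnonneg x i)
  · intro x hx
    obtain ⟨Z, hZ⟩ := ((hsummable x hx).hasSum.eventually (lt_mem_nhds (hlt x hx))).exists
    have hcont : ContinuousOn (fun y => ∑ i ∈ Z, f y i) K :=
      continuousOn_finsetSum Z fun i _ => hf i
    exact ⟨{y | c < ∑ i ∈ Z, f y i}, (hcont x hx).eventually (lt_mem_nhds hZ), Z,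
      fun y hy _ => hy⟩

/-- if each `ξ ↦ P_ξ(k)` is continuous on `[0,1]` and
`∑_{k∈ℤ} P_ξ(k) = 1` for every `ξ ∈ [0,1]`, then there are `δ > 0` and a finite
`Z₀ ⊂ ℤ` with `∑_{k∈Z₀} P_ξ(k) ≥ δ` for every `ξ ∈ [0,1]`; in particular every
`ξ` admits `k(ξ) ∈ Z₀` with `P_ξ(k(ξ)) ≥ δ / card Z₀`. -/
theorem statement9 (M : ℝ → ℝ)
    (hM01 : ∀ ξ : ℝ, M ξ ∈ Set.Icc (0 : ℝ) 1)
    (hMmeas : Measurable M)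
    (hMper : ∀ ξ : ℝ, M (ξ + 1) = M ξ)
    (hMsum : ∀ ξ : ℝ, M ξ + M (ξ + 1 / 2) = 1)
    (hM0 : M 0 = 1)
    (P : ℝ → ℤ → ℝ)
    (hP : ∀ (ξ : ℝ) (k : ℤ),
      Filter.Tendsto (fun N : ℕ => ∏ j ∈ Finset.range (N + 1), M ((ξ + (k : ℝ)) / 2 ^ (j + 1)))
        atTop (𝓝 (P ξ k)))
    (hcont : ∀ k : ℤ, ContinuousOn (fun ξ => P ξ k) (Set.Icc (0 : ℝ) 1))
    (hsum : ∀ ξ ∈ Set.Icc (0 : ℝ) 1, ∑' k : ℤ, P ξ k = 1) :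
    ∃ δ > (0 : ℝ), ∃ Z₀ : Finset ℤ,
      (∀ ξ ∈ Set.Icc (0 : ℝ) 1, δ ≤ ∑ k ∈ Z₀, P ξ k) ∧
      (∀ ξ ∈ Set.Icc (0 : ℝ) 1, ∃ k ∈ Z₀, δ / (Z₀.card : ℝ) ≤ P ξ k) := by
  have hnonneg (ξ : ℝ) (k : ℤ) : 0 ≤ P ξ k :=
    ge_of_tendsto' (hP ξ k) fun N => Finset.prod_nonneg fun j _ => (hM01 _).1
  obtain ⟨Z, hZ⟩ := isCompact_Icc.exists_finset_forall_lt_sum (c := 1 / 2) hcont hnonneg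
    (fun ξ hξ => by
      by_contra h
      have := hsum ξ hξ
      rw [tsum_eq_zero_of_not_summable h] at this
      exact zero_ne_one this)
    (fun ξ hξ => by rw [hsum ξ hξ]; norm_num)
  refine ⟨1 / 2, by norm_num, Z, fun ξ hξ => (hZ ξ hξ).le, fun ξ hξ => ?_⟩
  have hne : Z.Nonempty := by
    by_contra h
    have := hZ ξ hξ
    rw [Finset.not_nonempty_iff_eq_empty.mp h, Finset.sum_empty] at this
    norm_num at this
  have hcard : (Z.card : ℝ) ≠ 0 := by exact_mod_cast hne.card_ne_zero
  refine Finset.exists_le_of_sum_le hne ?_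
  rw [Finset.sum_const, nsmul_eq_mul, mul_div_cancel₀ _ hcard]
  exact (hZ ξ hξ).le
end

section
/- There exists a continuous 1-periodic function M : ℝ → [0,1] with M(ξ) + M(ξ + 1/2) = 1 for all ξ, M(0) = 1, and M infinitely differentiable on a neighborhood of 0, such that: (a) for each k ∈ ℤ the map ξ ↦ P_ξ(k) is continuous on [0,1]; (b) ∑_{k∈ℤ} P_ξ(k) = 1 for every ξ ∈ [0,1] with ξ ∉ {1/3, 2/3}; and (c) ∑_{k∈ℤ} P_{1/3}(k) = 0 and ∑_{k∈ℤ} P_{2/3}(k) = 0. In particular, condition (C) (existence of δ > 0 with sup_{k∈ℤ} P_ξ(k) ≥ δ for almost every ξ) fails for every δ > 0. -/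
open MeasureTheory Filter Topology Finset

/-- A `1`-periodic nonnegative function satisfying the quadrature mirror identity
`M x + M (x + 1/2) = 1`. -/
structure IsMirrorFilter (M : ℝ → ℝ) : Prop where
  nonneg : ∀ x, 0 ≤ M x
  add_one : ∀ x, M (x + 1) = M x
  add_half : ∀ x, M x + M (x + 1 / 2) = 1

/-- The infinite product `∏_{j ≥ 1} M (x / 2 ^ j)`, as the infimum of its partial products. -/
noncomputable def dyadicProduct (M : ℝ → ℝ) (x : ℝ) : ℝ :=
  ⨅ N : ℕ, ∏ j ∈ Finset.range N, M (x / 2 ^ (j + 1))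

/-- The sum of the infinite dyadic product over the translates of `x` by the integers. -/
noncomputable def dyadicSum (M : ℝ → ℝ) (x : ℝ) : ℝ :=
  ∑' k : ℤ, dyadicProduct M (x + k)

/-- The sum of the infinite dyadic product over the translates of `x` by the integers
in `[-n, n)`. -/
noncomputable def dyadicPartialSum (M : ℝ → ℝ) (n : ℕ) (x : ℝ) : ℝ :=
  ∑ i ∈ Finset.range n, (dyadicProduct M (x + i) + dyadicProduct M (x - (i + 1)))

namespace IsMirrorFilter

variable {M : ℝ → ℝ}

lemma le_one (hM : IsMirrorFilter M) (x : ℝ) : M x ≤ 1 := by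
  linarith [hM.add_half x, hM.nonneg (x + 1 / 2)]

lemma add_int (hM : IsMirrorFilter M) (x : ℝ) (n : ℤ) : M (x + n) = M x := by
  have h : Function.Periodic M 1 := hM.add_one
  simpa using h.int_mul n x

lemma tendsto_dyadicProduct (hM : IsMirrorFilter M) (x : ℝ) :
    Tendsto (fun N : ℕ => ∏ j ∈ Finset.range N, M (x / 2 ^ (j + 1))) atTop
      (𝓝 (dyadicProduct M x)) := by
  refine tendsto_atTop_ciInf (antitone_nat_of_succ_le fun n => ?_) ⟨0, ?_⟩
  · rw [Finset.prod_range_succ]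
    exact mul_le_of_le_one_right (Finset.prod_nonneg fun _ _ => hM.nonneg _) (hM.le_one _)
  · rintro _ ⟨N, rfl⟩
    exact Finset.prod_nonneg fun _ _ => hM.nonneg _

lemma dyadicProduct_nonneg (hM : IsMirrorFilter M) (x : ℝ) : 0 ≤ dyadicProduct M x :=
  ge_of_tendsto' (hM.tendsto_dyadicProduct x) fun _ => Finset.prod_nonneg fun _ _ => hM.nonneg _

lemma dyadicProduct_le_one (hM : IsMirrorFilter M) (x : ℝ) : dyadicProduct M x ≤ 1 :=
  le_of_tendsto' (hM.tendsto_dyadicProduct x) fun _ =>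
    Finset.prod_le_one (fun _ _ => hM.nonneg _) fun _ _ => hM.le_one _

lemma dyadicProduct_two_mul (hM : IsMirrorFilter M) (x : ℝ) :
    dyadicProduct M (2 * x) = M x * dyadicProduct M x := by
  refine tendsto_nhds_unique
    ((hM.tendsto_dyadicProduct (2 * x)).comp (tendsto_add_atTop_nat 1)) ?_
  refine ((hM.tendsto_dyadicProduct x).const_mul (M x)).congr fun N => ?_
  rw [Function.comp_apply, Finset.prod_range_succ', mul_comm]
  congr 1
  · refine Finset.prod_congr rfl fun j _ => ?_
    congr 1
    rw [pow_succ' 2 (j + 1), mul_div_mul_left _ _ two_ne_zero]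
  · simp

lemma dyadicProduct_le (hM : IsMirrorFilter M) (x : ℝ) : dyadicProduct M x ≤ M (x / 2) := by
  have h := hM.dyadicProduct_two_mul (x / 2)
  rw [mul_div_cancel₀ x two_ne_zero] at h
  rw [h]
  exact mul_le_of_le_one_right (hM.nonneg _) (hM.dyadicProduct_le_one _)

lemma dyadicProduct_le_half (hM : IsMirrorFilter M) (x : ℝ) :
    dyadicProduct M x ≤ dyadicProduct M (x / 2) := by
  have h := hM.dyadicProduct_two_mul (x / 2)
  rw [mul_div_cancel₀ x two_ne_zero] at h
  rw [h]
  exact mul_le_of_le_one_left (hM.dyadicProduct_nonneg _) (hM.le_one _)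

lemma dyadicPartialSum_two_mul (hM : IsMirrorFilter M) (n : ℕ) (x : ℝ) :
    dyadicPartialSum M (2 * n) (2 * x) =
      M x * dyadicPartialSum M n x + M (x + 1 / 2) * dyadicPartialSum M n (x + 1 / 2) := by
  have key (y : ℝ) (k : ℤ) :
      dyadicProduct M (2 * (y + k)) = M y * dyadicProduct M (y + k) := by
    rw [hM.dyadicProduct_two_mul, hM.add_int]
  induction n with
  | zero => simp [dyadicPartialSum]
  | succ n ih =>
    have h1 := key x n
    have h2 := key (x + 1 / 2) n
    have h3 := key x (-(n + 1))
    have h4 := key (x + 1 / 2) (-(n + 1))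
    unfold dyadicPartialSum at ih ⊢
    rw [show 2 * (n + 1) = 2 * n + 1 + 1 by ring, Finset.sum_range_succ, Finset.sum_range_succ, ih,
      Finset.sum_range_succ, Finset.sum_range_succ]
    push_cast at h1 h2 h3 h4 ⊢
    rw [show 2 * x + 2 * (n : ℝ) = 2 * (x + n) by ring, h1,
      show 2 * x - (2 * (n : ℝ) + 1) = 2 * (x + 1 / 2 + -(n + 1)) by ring, h4,
      show 2 * x + (2 * (n : ℝ) + 1) = 2 * (x + 1 / 2 + n) by ring, h2,
      show 2 * x - (2 * (n : ℝ) + 1 + 1) = 2 * (x + -(n + 1)) by ring, h3]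
    simp only [← sub_eq_add_neg]
    ring

lemma dyadicPartialSum_le_one (hM : IsMirrorFilter M) (n : ℕ) (x : ℝ) :
    dyadicPartialSum M n x ≤ 1 := by
  have hpow (N : ℕ) : ∀ y, dyadicPartialSum M (2 ^ N) y ≤ 1 := by
    induction N with
    | zero =>
      intro y
      have h1 := hM.dyadicProduct_le y
      have h2 := hM.dyadicProduct_le (y - 1)
      have h3 := hM.add_half ((y - 1) / 2)
      rw [show (y - 1) / 2 + 1 / 2 = y / 2 by ring] at h3
      simp only [dyadicPartialSum, pow_zero, Finset.sum_range_one, Nat.cast_zero, add_zero,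
        zero_add]
      linarith
    | succ N ih =>
      intro y
      have h := hM.dyadicPartialSum_two_mul (2 ^ N) (y / 2)
      rw [mul_div_cancel₀ y two_ne_zero, ← pow_succ'] at h
      rw [h]
      nlinarith [hM.add_half (y / 2), hM.nonneg (y / 2), hM.nonneg (y / 2 + 1 / 2),
        ih (y / 2), ih (y / 2 + 1 / 2)]
  refine le_trans ?_ (hpow n x)
  exact Finset.sum_le_sum_of_subset_of_nonneg
    (Finset.range_subset_range.2 Nat.lt_two_pow_self.le) fun _ _ _ =>
      add_nonneg (hM.dyadicProduct_nonneg _) (hM.dyadicProduct_nonneg _)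

lemma summable_dyadicProduct (hM : IsMirrorFilter M) (x : ℝ) :
    Summable fun k : ℤ => dyadicProduct M (x + k) := by
  refine Summable.of_nat_of_neg_add_one
    (summable_of_sum_range_le (fun _ => hM.dyadicProduct_nonneg _) fun n =>
      le_trans (Finset.sum_le_sum fun i _ => ?_) (hM.dyadicPartialSum_le_one n x))
    (summable_of_sum_range_le (fun _ => hM.dyadicProduct_nonneg _) fun n =>
      le_trans (Finset.sum_le_sum fun i _ => ?_) (hM.dyadicPartialSum_le_one n x))
  · simpa using hM.dyadicProduct_nonneg _
  · push_cast
    rw [← sub_eq_add_neg]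
    linarith [hM.dyadicProduct_nonneg (x + i)]

lemma tendsto_dyadicPartialSum (hM : IsMirrorFilter M) (x : ℝ) :
    Tendsto (fun n => dyadicPartialSum M n x) atTop (𝓝 (dyadicSum M x)) := by
  have hs := hM.summable_dyadicProduct x
  have h1 : Summable fun i : ℕ => dyadicProduct M (x + (i : ℤ)) :=
    hs.comp_injective Nat.cast_injective
  have h2 : Summable fun i : ℕ => dyadicProduct M (x + (-((i : ℤ) + 1) : ℤ)) :=
    hs.comp_injective (i := fun i : ℕ => -((i : ℤ) + 1)) fun i j h => by simpa using h
  have h3 := (h1.hasSum.add h2.hasSum).tendsto_sum_nat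
  have h4 := tsum_of_nat_of_neg_add_one (f := fun k : ℤ => dyadicProduct M (x + k)) h1 h2
  rw [dyadicSum, h4]
  refine h3.congr fun n => Finset.sum_congr rfl fun i _ => ?_
  push_cast
  rw [← sub_eq_add_neg]

lemma dyadicSum_le_one (hM : IsMirrorFilter M) (x : ℝ) : dyadicSum M x ≤ 1 :=
  le_of_tendsto' (hM.tendsto_dyadicPartialSum x) fun n => hM.dyadicPartialSum_le_one n x

lemma dyadicProduct_le_dyadicSum (hM : IsMirrorFilter M) (x : ℝ) :
    dyadicProduct M x ≤ dyadicSum M x := by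
  simpa [dyadicSum] using (hM.summable_dyadicProduct x).le_tsum 0 fun _ _ => hM.dyadicProduct_nonneg _

lemma dyadicSum_two_mul (hM : IsMirrorFilter M) (x : ℝ) :
    dyadicSum M (2 * x) = M x * dyadicSum M x + M (x + 1 / 2) * dyadicSum M (x + 1 / 2) := by
  have h2 : Tendsto (fun n : ℕ => 2 * n) atTop atTop :=
    tendsto_id.const_mul_atTop' two_pos
  refine tendsto_nhds_unique ((hM.tendsto_dyadicPartialSum (2 * x)).comp h2) ?_
  exact (((hM.tendsto_dyadicPartialSum x).const_mul _).add
    ((hM.tendsto_dyadicPartialSum (x + 1 / 2)).const_mul _)).congr fun n =>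
      (hM.dyadicPartialSum_two_mul n x).symm

lemma dyadicProduct_eq_one (hM : IsMirrorFilter M) {r : ℝ} (hr : ∀ x, |x| ≤ r → M x = 1)
    {x : ℝ} (hx : |x| ≤ 2 * r) : dyadicProduct M x = 1 := by
  refine tendsto_nhds_unique (hM.tendsto_dyadicProduct x) ?_
  refine tendsto_const_nhds.congr fun N => (Finset.prod_eq_one fun j _ => hr _ ?_).symm
  rw [abs_div, abs_of_pos (by positivity : (0 : ℝ) < 2 ^ (j + 1)), div_le_iff₀ (by positivity)]
  have h0 : 0 ≤ r := by linarith [abs_nonneg x]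
  have h1 : (1 : ℝ) ≤ 2 ^ j := one_le_pow₀ one_le_two
  rw [pow_succ]
  nlinarith

lemma dyadicSum_eq_one (hM : IsMirrorFilter M) {r : ℝ} (hr : ∀ x, |x| ≤ r → M x = 1)
    {x : ℝ} (hx : |x| ≤ 2 * r) : dyadicSum M x = 1 :=
  le_antisymm (hM.dyadicSum_le_one x)
    ((hM.dyadicProduct_eq_one hr hx).symm.le.trans (hM.dyadicProduct_le_dyadicSum x))

lemma dyadicProduct_eq_prod_mul (hM : IsMirrorFilter M) (n : ℕ) (x : ℝ) :
    dyadicProduct M x =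
      (∏ j ∈ Finset.range n, M (x / 2 ^ (j + 1))) * dyadicProduct M (x / 2 ^ n) := by
  induction n with
  | zero => simp
  | succ n ih =>
    have h := hM.dyadicProduct_two_mul (x / 2 ^ (n + 1))
    rw [show 2 * (x / 2 ^ (n + 1)) = x / 2 ^ n by field_simp; ring] at h
    rw [ih, h, Finset.prod_range_succ, mul_assoc]

lemma continuous_dyadicProduct (hM : IsMirrorFilter M) (hc : Continuous M) {r : ℝ} (hr0 : 0 < r)
    (hr : ∀ x, |x| ≤ r → M x = 1) : Continuous (dyadicProduct M) := by
  refine continuous_iff_continuousAt.2 fun x₀ => ?_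
  obtain ⟨n, hn⟩ := pow_unbounded_of_one_lt (|x₀| / (2 * r)) one_lt_two
  have hcont : Continuous fun x => ∏ j ∈ Finset.range n, M (x / 2 ^ (j + 1)) :=
    continuous_finsetProd _ fun j _ => hc.comp (continuous_id.div_const _)
  refine hcont.continuousAt.congr ?_
  rw [div_lt_iff₀ (by positivity)] at hn
  filter_upwards [continuous_abs.continuousAt.eventually_lt continuousAt_const hn] with x hx
  rw [hM.dyadicProduct_eq_prod_mul n x, hM.dyadicProduct_eq_one hr, mul_one]
  rw [abs_div, abs_of_pos (by positivity : (0 : ℝ) < 2 ^ n), div_le_iff₀ (by positivity)]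
  linarith

lemma dyadicSum_add_one (x : ℝ) : dyadicSum M (x + 1) = dyadicSum M x := by
  unfold dyadicSum
  rw [← (Equiv.addRight (1 : ℤ)).tsum_eq fun k : ℤ => dyadicProduct M (x + k)]
  refine tsum_congr fun k => ?_
  simp only [Equiv.coe_addRight]
  push_cast
  ring_nf

lemma dyadicProduct_neg (he : ∀ x, M (-x) = M x) (x : ℝ) :
    dyadicProduct M (-x) = dyadicProduct M x := by
  simp [dyadicProduct, neg_div, he]

lemma dyadicSum_neg (he : ∀ x, M (-x) = M x) (x : ℝ) : dyadicSum M (-x) = dyadicSum M x := by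
  unfold dyadicSum
  rw [← (Equiv.neg ℤ).tsum_eq fun k : ℤ => dyadicProduct M (x + k)]
  refine tsum_congr fun k => ?_
  rw [← dyadicProduct_neg he]
  simp only [Equiv.neg_apply]
  push_cast
  ring_nf

lemma dyadicSum_one_sub (he : ∀ x, M (-x) = M x) (x : ℝ) :
    dyadicSum M (1 - x) = dyadicSum M x := by
  rw [← dyadicSum_neg he x, ← dyadicSum_add_one (-x)]
  ring_nf

/-- The defect `1 - dyadicSum` is transported along the map `y ↦ (1 - y) / 2`,
whose fixed point is `1 / 3`. -/
lemma one_sub_dyadicSum (hM : IsMirrorFilter M) (he : ∀ x, M (-x) = M x)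
    (hr : ∀ x, |x| ≤ 1 / 8 → M x = 1) {y : ℝ} (hy : y ∈ Set.Icc (1 / 4 : ℝ) (1 / 2)) :
    1 - dyadicSum M y = M ((1 - y) / 2) * (1 - dyadicSum M ((1 - y) / 2)) := by
  have h := hM.dyadicSum_two_mul (y / 2)
  have hM' : M (y / 2 + 1 / 2) = M ((1 - y) / 2) := by
    rw [← he ((1 - y) / 2), ← hM.add_one (-((1 - y) / 2))]
    ring_nf
  have hS : dyadicSum M (y / 2 + 1 / 2) = dyadicSum M ((1 - y) / 2) := by
    rw [← dyadicSum_one_sub he ((1 - y) / 2)]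
    ring_nf
  have h1 : dyadicSum M (y / 2) = 1 := by
    refine hM.dyadicSum_eq_one hr ?_
    rw [abs_of_nonneg (by linarith [hy.1])]
    linarith [hy.2]
  have h2 := hM.add_half (y / 2)
  rw [mul_div_cancel₀ y two_ne_zero, hM', hS, h1] at h
  rw [hM'] at h2
  rw [h]
  linear_combination -h2

/-- The infinite product is uniformly small near the points `n / 3` with `3 ∤ n`
as soon as the filter is small near the points `n / 6` with `n` odd and `3 ∤ n`. -/
lemma dyadicProduct_le_of_near_third (hM : IsMirrorFilter M) {ε η : ℝ}
    (h : ∀ (n : ℤ) (x : ℝ), Odd n → ¬ 3 ∣ n → |x - n / 6| ≤ η → M x ≤ ε)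
    (n : ℤ) (x : ℝ) (hn : ¬ 3 ∣ n) (hx : |x - n / 3| ≤ η) : dyadicProduct M x ≤ ε := by
  induction hk : n.natAbs using Nat.strong_induction_on generalizing n x with
  | _ k ih =>
    have hη : 0 ≤ η := (abs_nonneg _).trans hx
    rw [abs_le] at hx
    rcases Int.even_or_odd' n with ⟨m, hm | hm⟩
    · refine (hM.dyadicProduct_le_half x).trans
        (ih m.natAbs (by omega) m (x / 2) (by omega) ?_ rfl)
      rw [hm] at hx
      push_cast at hx
      rw [abs_le]
      constructor <;> linarith [hx.1, hx.2]
    · refine (hM.dyadicProduct_le x).trans (h n (x / 2) ⟨m, hm⟩ hn ?_)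
      rw [abs_le]
      constructor <;> linarith [hx.1, hx.2]

end IsMirrorFilter

/-- An even modulus with logarithmically slow decay at `0`, equal to `1` for `|t| ≥ 1/24`. -/
noncomputable def logModulus : ℝ → ℝ :=
  Function.update (fun t => (1 + max 0 (-Real.log (24 * t)))⁻¹) 0 0

lemma logModulus_zero : logModulus 0 = 0 := Function.update_self ..

lemma logModulus_of_ne_zero {t : ℝ} (ht : t ≠ 0) :
    logModulus t = (1 + max 0 (-Real.log (24 * t)))⁻¹ := Function.update_of_ne ht ..

lemma logModulus_nonneg (t : ℝ) : 0 ≤ logModulus t := by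
  rcases eq_or_ne t 0 with rfl | ht
  · exact logModulus_zero.ge
  · rw [logModulus_of_ne_zero ht]
    positivity

lemma logModulus_le_one (t : ℝ) : logModulus t ≤ 1 := by
  rcases eq_or_ne t 0 with rfl | ht
  · exact logModulus_zero.le.trans zero_le_one
  · rw [logModulus_of_ne_zero ht]
    exact inv_le_one_of_one_le₀ (by linarith [le_max_left 0 (-Real.log (24 * t))])

lemma logModulus_eq_one {t : ℝ} (ht : 1 / 24 ≤ t) : logModulus t = 1 := by
  rw [logModulus_of_ne_zero (by linarith),
    max_eq_left (by linarith [Real.log_nonneg (show 1 ≤ 24 * t by linarith)])]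
  norm_num

lemma logModulus_neg (t : ℝ) : logModulus (-t) = logModulus t := by
  rcases eq_or_ne t 0 with rfl | ht
  · rw [neg_zero]
  · rw [logModulus_of_ne_zero ht, logModulus_of_ne_zero (neg_ne_zero.2 ht), mul_neg,
      Real.log_neg_eq_log]

lemma continuous_logModulus : Continuous logModulus := by
  refine continuous_iff_continuousAt.2 fun t => ?_
  rcases eq_or_ne t 0 with rfl | ht
  · refine continuousAt_update_same.2 (Tendsto.inv_tendsto_atTop ?_)
    refine tendsto_atTop_add_const_left _ _ (tendsto_atTop_mono (fun t => le_max_right 0 _) ?_)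
    refine tendsto_neg_atBot_atTop.comp (Real.tendsto_log_nhdsNE_zero.comp ?_)
    refine tendsto_nhdsWithin_iff.2 ⟨?_, ?_⟩
    · have h : Continuous fun t : ℝ => 24 * t := by fun_prop
      simpa using (h.tendsto 0).mono_left nhdsWithin_le_nhds
    · filter_upwards [self_mem_nhdsWithin] with t ht
      simpa using ht
  · refine (continuousAt_update_of_ne ht).2 (ContinuousAt.inv₀ ?_ (by positivity))
    exact continuousAt_const.add (continuousAt_const.max
      ((Real.continuousAt_log (by simpa using ht)).comp (by fun_prop)).neg)

/-- The distance from a real number to the nearest integer. -/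
noncomputable def intDist (x : ℝ) : ℝ := ‖(x : UnitAddCircle)‖

lemma continuous_intDist : Continuous intDist :=
  continuous_norm.comp (AddCircle.continuous_mk' 1)

lemma intDist_neg (x : ℝ) : intDist (-x) = intDist x := by
  simp [intDist]

lemma intDist_add_one (x : ℝ) : intDist (x + 1) = intDist x := by
  simp [intDist]

lemma intDist_eq_abs {x : ℝ} (hx : |x| ≤ 1 / 2) : intDist x = |x| :=
  (AddCircle.norm_coe_eq_abs_iff 1 one_ne_zero).2 (by simpa using hx)

lemma intDist_add_half (x : ℝ) : intDist (x + 1 / 2) = 1 / 2 - intDist x := by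
  have hper : Function.Periodic intDist 1 := intDist_add_one
  have hx := abs_le.1 (abs_sub_round x)
  obtain ⟨t, ht⟩ : ∃ t, t = x - round x := ⟨_, rfl⟩
  rw [← ht] at hx
  have h1 : intDist x = intDist t := by
    simpa [ht] using (hper.sub_int_mul_eq (x := x) (round x)).symm
  have h2 : intDist (x + 1 / 2) = intDist (t + 1 / 2) := by
    rw [← hper.sub_int_mul_eq (x := x + 1 / 2) (round x), ht]
    ring_nf
  rw [h1, h2, intDist_eq_abs (abs_le.2 hx)]
  rcases le_total 0 t with h | h
  · rw [show t + 1 / 2 = t - 1 / 2 + 1 by ring, intDist_add_one,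
      intDist_eq_abs (abs_le.2 ⟨by linarith, by linarith⟩), abs_of_nonneg h,
      abs_of_nonpos (by linarith)]
    ring
  · rw [intDist_eq_abs (abs_le.2 ⟨by linarith, by linarith⟩), abs_of_nonpos h,
      abs_of_nonneg (by linarith)]
    ring

/-- The truncation of a real number to `[-1, 1]`. -/
def unitClamp (s : ℝ) : ℝ := max (-1) (min 1 s)

lemma abs_unitClamp_le (s : ℝ) : |unitClamp s| ≤ 1 :=
  abs_le.2 ⟨le_max_left _ _, max_le (by norm_num) (min_le_left _ _)⟩

lemma unitClamp_neg (s : ℝ) : unitClamp (-s) = -unitClamp s := by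
  unfold unitClamp
  grind

lemma unitClamp_of_one_le {s : ℝ} (hs : 1 ≤ s) : unitClamp s = 1 := by
  unfold unitClamp
  grind

lemma unitClamp_nonpos {s : ℝ} (hs : s ≤ 0) : unitClamp s ≤ 0 := by
  unfold unitClamp
  grind

/-- A mirror filter equal to `1` near the integers, with logarithmic cusps at the points of
the cycle `{1/3, 2/3}`, where it also takes the value `1`. -/
noncomputable def cuspFilter (x : ℝ) : ℝ :=
  1 / 2 + unitClamp (24 * (1 / 4 - intDist x)) *
    (2 * logModulus (|1 / 4 - intDist x| - 1 / 12) - 1) / 2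

lemma cuspFilter_neg (x : ℝ) : cuspFilter (-x) = cuspFilter x := by
  rw [cuspFilter, cuspFilter, intDist_neg]

lemma isMirrorFilter_cuspFilter : IsMirrorFilter cuspFilter where
  nonneg x := by
    have h1 := abs_unitClamp_le (24 * (1 / 4 - intDist x))
    have h2 : |2 * logModulus (|1 / 4 - intDist x| - 1 / 12) - 1| ≤ 1 :=
      abs_le.2 ⟨by linarith [logModulus_nonneg (|1 / 4 - intDist x| - 1 / 12)],
        by linarith [logModulus_le_one (|1 / 4 - intDist x| - 1 / 12)]⟩
    have h3 := mul_le_one₀ h1 (abs_nonneg _) h2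
    rw [← abs_mul] at h3
    rw [cuspFilter]
    linarith [(abs_le.1 h3).1]
  add_one x := by rw [cuspFilter, cuspFilter, intDist_add_one]
  add_half x := by
    rw [cuspFilter, cuspFilter, intDist_add_half,
      show 1 / 4 - (1 / 2 - intDist x) = -(1 / 4 - intDist x) by ring, abs_neg, mul_neg,
      unitClamp_neg]
    ring

lemma continuous_cuspFilter : Continuous cuspFilter := by
  have h1 := continuous_intDist
  have h2 := continuous_logModulus
  unfold cuspFilter unitClamp
  fun_prop

lemma cuspFilter_eq_one {x : ℝ} (hx : |x| ≤ 1 / 8) : cuspFilter x = 1 := by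
  rw [cuspFilter, intDist_eq_abs (by linarith), unitClamp_of_one_le (by linarith),
    abs_of_nonneg (by linarith), logModulus_eq_one (by linarith)]
  norm_num

lemma cuspFilter_one_sixth : cuspFilter (1 / 6) = 0 := by
  rw [cuspFilter, intDist_eq_abs (by rw [abs_of_pos] <;> norm_num), abs_of_pos (by norm_num),
    unitClamp_of_one_le (by norm_num), abs_of_pos (by norm_num)]
  norm_num [logModulus_zero]

lemma cuspFilter_le {y : ℝ} (hy : y ∈ Set.Icc (1 / 4 : ℝ) (1 / 2)) :
    cuspFilter y ≤ 1 - logModulus (y - 1 / 3) / 2 := by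
  have hd : intDist y = y := by
    have h : |y| = y := abs_of_nonneg (by linarith [hy.1])
    rw [intDist_eq_abs (h.trans_le hy.2), h]
  rw [cuspFilter, hd, abs_of_nonpos (by linarith [hy.1]),
    show -(1 / 4 - y) - 1 / 12 = y - 1 / 3 by ring]
  have h1 := unitClamp_nonpos (show 24 * (1 / 4 - y) ≤ 0 by linarith [hy.1])
  have h2 := (abs_le.1 (abs_unitClamp_le (24 * (1 / 4 - y)))).1
  have h3 := logModulus_nonneg (y - 1 / 3)
  have h4 := logModulus_le_one (y - 1 / 3)
  nlinarith

/-- Near an odd multiple of `1/6` that is not a multiple of `1/2` the filter is small. -/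
lemma exists_cuspFilter_le {ε : ℝ} (hε : 0 < ε) : ∃ η > 0, ∀ (n : ℤ) (x : ℝ), Odd n → ¬ 3 ∣ n →
    |x - n / 6| ≤ η → cuspFilter x ≤ ε := by
  obtain ⟨η, hη, h⟩ := Metric.continuousAt_iff.1 (continuous_cuspFilter.continuousAt
    (x := 1 / 6)) ε hε
  have key (y : ℝ) (hy : |y - 1 / 6| ≤ η / 2) : cuspFilter y ≤ ε := by
    have := h (x := y) (by rw [Real.dist_eq]; linarith)
    rw [cuspFilter_one_sixth, Real.dist_eq, sub_zero] at this
    exact (le_abs_self _).trans this.le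
  refine ⟨η / 2, by positivity, fun n x hn h3 hx => ?_⟩
  obtain ⟨q, hq | hq⟩ : ∃ q : ℤ, n = 6 * q + 1 ∨ n = 6 * q - 1 := by
    obtain ⟨m, rfl⟩ := hn
    exact ⟨(2 * m + 2) / 6, by omega⟩
  · rw [← isMirrorFilter_cuspFilter.add_int x (-q)]
    refine key _ (le_of_eq_of_le (congrArg _ ?_) hx)
    rw [hq]
    push_cast
    ring
  · rw [← isMirrorFilter_cuspFilter.add_int x (-q), ← cuspFilter_neg]
    refine key _ (le_of_eq_of_le ?_ hx)
    rw [hq, ← abs_neg]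
    push_cast
    ring_nf

lemma exists_dyadicProduct_cuspFilter_le {ε : ℝ} (hε : 0 < ε) : ∃ η > 0, ∀ (n : ℤ) (x : ℝ),
    ¬ 3 ∣ n → |x - n / 3| ≤ η → dyadicProduct cuspFilter x ≤ ε := by
  obtain ⟨η, hη, h⟩ := exists_cuspFilter_le hε
  exact ⟨η, hη, isMirrorFilter_cuspFilter.dyadicProduct_le_of_near_third h⟩

lemma dyadicProduct_cuspFilter_third {n : ℤ} (hn : ¬ 3 ∣ n) :
    dyadicProduct cuspFilter (n / 3) = 0 := by
  refine le_antisymm (le_of_forall_pos_le_add fun ε hε => ?_)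
    (isMirrorFilter_cuspFilter.dyadicProduct_nonneg _)
  obtain ⟨η, hη, h⟩ := exists_dyadicProduct_cuspFilter_le hε
  rw [zero_add]
  exact h n _ hn (by simpa using hη.le)

/-- Halving `t` increases the reciprocal of `logModulus t` by at most `1`. -/
lemma inv_le_logModulus_half {t : ℝ} (ht : t ≠ 0) {d : ℝ}
    (hd : max 0 (-Real.log (24 * t)) ≤ d) :
    max 0 (-Real.log (24 * (t / 2))) ≤ d + 1 ∧ (d + 2)⁻¹ ≤ logModulus (t / 2) := by
  have h1 : max 0 (-Real.log (24 * (t / 2))) ≤ d + 1 := by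
    rw [max_le_iff] at hd
    rw [← mul_div_assoc, Real.log_div (by simpa using ht) two_ne_zero]
    have := Real.log_two_lt_d9
    exact max_le (by linarith) (by linarith)
  refine ⟨h1, ?_⟩
  rw [logModulus_of_ne_zero (by simpa using ht)]
  exact inv_anti₀ (by positivity) (by linarith)

lemma one_sub_dyadicSum_cuspFilter_le (n : ℕ) {y d : ℝ} (hy : y ∈ Set.Icc (1 / 4 : ℝ) (1 / 2))
    (hy3 : y ≠ 1 / 3) (hd : max 0 (-Real.log (24 * (y - 1 / 3))) ≤ d) :
    1 - dyadicSum cuspFilter y ≤ Real.exp (-∑ i ∈ Finset.range n, (d + i + 2)⁻¹ / 2) := by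
  have hM := isMirrorFilter_cuspFilter
  induction n generalizing y d with
  | zero =>
    have h0 := (hM.dyadicProduct_nonneg y).trans (hM.dyadicProduct_le_dyadicSum y)
    simpa using h0
  | succ n ih =>
    have ht : y - 1 / 3 ≠ 0 := sub_ne_zero.2 hy3
    have hT : (1 - y) / 2 - 1 / 3 = -((y - 1 / 3) / 2) := by ring
    have hTy : (1 - y) / 2 ∈ Set.Icc (1 / 4 : ℝ) (1 / 2) :=
      ⟨by linarith [hy.2], by linarith [hy.1]⟩
    obtain ⟨h1, h2⟩ := inv_le_logModulus_half ht hd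
    have h3 := cuspFilter_le hTy
    rw [hT, logModulus_neg] at h3
    have h4 := ih hTy (fun h => ht (by linarith)) (d := d + 1)
      (by rwa [hT, mul_neg, Real.log_neg_eq_log])
    have h5 : cuspFilter ((1 - y) / 2) ≤ Real.exp (-((d + 2)⁻¹ / 2)) := by
      linarith [Real.add_one_le_exp (-((d + 2)⁻¹ / 2))]
    rw [hM.one_sub_dyadicSum cuspFilter_neg (fun _ => cuspFilter_eq_one) hy]
    refine (mul_le_mul h5 h4 (by linarith [hM.dyadicSum_le_one ((1 - y) / 2)])
      (Real.exp_nonneg _)).trans_eq ?_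
    rw [← Real.exp_add, Finset.sum_range_succ']
    congr 1
    have hsum : ∑ i ∈ Finset.range n, (d + 1 + i + 2)⁻¹ / 2 =
        ∑ i ∈ Finset.range n, (d + (i + 1 : ℕ) + 2)⁻¹ / 2 :=
      Finset.sum_congr rfl fun i _ => by push_cast; ring_nf
    rw [hsum]
    push_cast
    ring_nf

lemma tendsto_sum_inv_add_atTop {d : ℝ} (hd : 0 ≤ d) :
    Tendsto (fun n : ℕ => ∑ i ∈ Finset.range n, (d + i + 2)⁻¹ / 2) atTop atTop := by
  refine tendsto_atTop_mono (fun n => ?_)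
    (Real.tendsto_sum_range_one_div_nat_succ_atTop.const_mul_atTop
      (show 0 < (2 * (d + 2))⁻¹ by positivity))
  rw [Finset.mul_sum]
  refine Finset.sum_le_sum fun i _ => ?_
  rw [one_div, ← mul_inv, div_eq_mul_inv, ← mul_inv]
  refine inv_anti₀ (by positivity) ?_
  have : 0 ≤ d * i := by positivity
  have : (0 : ℝ) ≤ i := by positivity
  nlinarith

lemma dyadicSum_cuspFilter_of_mem_Icc {y : ℝ} (hy : y ∈ Set.Icc (1 / 4 : ℝ) (1 / 2))
    (hy3 : y ≠ 1 / 3) : dyadicSum cuspFilter y = 1 := by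
  refine le_antisymm (isMirrorFilter_cuspFilter.dyadicSum_le_one y) (sub_nonpos.1 ?_)
  exact ge_of_tendsto' (Real.tendsto_exp_neg_atTop_nhds_zero.comp
    (tendsto_sum_inv_add_atTop (le_max_left _ _)))
    fun n => one_sub_dyadicSum_cuspFilter_le n hy hy3 le_rfl

lemma dyadicSum_cuspFilter {x : ℝ} (hx : x ∈ Set.Icc (0 : ℝ) 1) (h1 : x ≠ 1 / 3)
    (h2 : x ≠ 2 / 3) : dyadicSum cuspFilter x = 1 := by
  have key (y : ℝ) (hy0 : 0 ≤ y) (hy : y ≤ 1 / 2) (hy3 : y ≠ 1 / 3) :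
      dyadicSum cuspFilter y = 1 := by
    rcases le_total y (1 / 4) with h | h
    · refine isMirrorFilter_cuspFilter.dyadicSum_eq_one (fun _ => cuspFilter_eq_one) ?_
      rw [abs_of_nonneg hy0]
      linarith
    · exact dyadicSum_cuspFilter_of_mem_Icc ⟨h, hy⟩ hy3
  rcases le_total x (1 / 2) with h | h
  · exact key x hx.1 h h1
  · rw [← IsMirrorFilter.dyadicSum_one_sub cuspFilter_neg]
    exact key _ (by linarith [hx.2]) (by linarith) fun h => h2 (by linarith)

lemma dyadicSum_cuspFilter_third {n : ℤ} (hn : ¬ 3 ∣ n) : dyadicSum cuspFilter (n / 3) = 0 := by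
  refine (tsum_congr fun k : ℤ => ?_).trans tsum_zero
  have h := dyadicProduct_cuspFilter_third (show ¬ 3 ∣ n + 3 * k by omega)
  push_cast at h
  rwa [add_div, mul_div_cancel_left₀ _ three_ne_zero] at h

lemma not_ae_le_iSup_dyadicProduct_cuspFilter {δ : ℝ} (hδ : 0 < δ) :
    ¬ ∀ᵐ ξ ∂(volume.restrict (Set.Icc (0 : ℝ) 1)),
      δ ≤ ⨆ k : ℤ, dyadicProduct cuspFilter (ξ + k) := by
  intro hae
  obtain ⟨η, hη, h⟩ := exists_dyadicProduct_cuspFilter_le (half_pos hδ)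
  have hsub : Set.Ioo (1 / 3) (1 / 3 + min η (1 / 2)) ⊆ Set.Icc (0 : ℝ) 1 := fun ξ hξ =>
    ⟨by linarith [hξ.1], by linarith [hξ.2, min_le_right η (1 / 2)]⟩
  have hfalse : ∀ᵐ ξ ∂(volume.restrict (Set.Ioo (1 / 3 : ℝ) (1 / 3 + min η (1 / 2)))), False := by
    filter_upwards [ae_restrict_of_ae_restrict_of_subset hsub hae,
      ae_restrict_mem measurableSet_Ioo] with ξ hξ hmem
    have hle : ⨆ k : ℤ, dyadicProduct cuspFilter (ξ + k) ≤ δ / 2 := by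
      refine ciSup_le fun k => h (1 + 3 * k) _ (by omega) ?_
      rw [abs_le]
      push_cast
      constructor <;> linarith [hmem.1, hmem.2, min_le_left η (1 / 2)]
    linarith
  rw [eventually_false_iff_eq_bot, ae_eq_bot, Measure.restrict_eq_zero, Real.volume_Ioo,
    ENNReal.ofReal_eq_zero] at hfalse
  linarith [lt_min hη (one_half_pos (α := ℝ))]

/-- part (iii) of Theorem 2: there is a continuous `1`-periodic
filter `M : ℝ → [0,1]` with `M(ξ) + M(ξ+1/2) = 1`, `M(0) = 1`, smooth near `0`,
whose infinite products `P_ξ(k)` are continuous in `ξ` for each `k`, with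
`∑_k P_ξ(k) = 1` for every `ξ ∈ [0,1] \ {1/3, 2/3}` but
`∑_k P_{1/3}(k) = ∑_k P_{2/3}(k) = 0`; in particular condition (C) fails for
every `δ > 0`. -/
theorem statement10 :
    ∃ (M : ℝ → ℝ) (P : ℝ → ℤ → ℝ),
      Continuous M ∧
      (∀ ξ : ℝ, M ξ ∈ Set.Icc (0 : ℝ) 1) ∧
      (∀ ξ : ℝ, M (ξ + 1) = M ξ) ∧
      (∀ ξ : ℝ, M ξ + M (ξ + 1 / 2) = 1) ∧
      M 0 = 1 ∧
      (∃ U ∈ 𝓝 (0 : ℝ), ContDiffOn ℝ (⊤ : ℕ∞) M U) ∧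
      (∀ (ξ : ℝ) (k : ℤ),
        Filter.Tendsto
          (fun N : ℕ => ∏ j ∈ Finset.range (N + 1), M ((ξ + (k : ℝ)) / 2 ^ (j + 1)))
          atTop (𝓝 (P ξ k))) ∧
      (∀ k : ℤ, ContinuousOn (fun ξ => P ξ k) (Set.Icc (0 : ℝ) 1)) ∧
      (∀ ξ ∈ Set.Icc (0 : ℝ) 1, ξ ≠ 1 / 3 → ξ ≠ 2 / 3 → ∑' k : ℤ, P ξ k = 1) ∧
      (∑' k : ℤ, P (1 / 3) k = 0) ∧
      (∑' k : ℤ, P (2 / 3) k = 0) ∧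
      (∀ δ > (0 : ℝ),
        ¬ (∀ᵐ ξ ∂(volume.restrict (Set.Icc (0 : ℝ) 1)), δ ≤ ⨆ k : ℤ, P ξ k)) := by
  have hM := isMirrorFilter_cuspFilter
  refine ⟨cuspFilter, fun ξ k => dyadicProduct cuspFilter (ξ + k), continuous_cuspFilter,
    fun ξ => ⟨hM.nonneg ξ, hM.le_one ξ⟩, hM.add_one, hM.add_half, cuspFilter_eq_one (by simp),
    ⟨Metric.ball 0 (1 / 8), Metric.ball_mem_nhds _ (by norm_num), ?_⟩,
    fun ξ k => (hM.tendsto_dyadicProduct _).comp (tendsto_add_atTop_nat 1), fun k => ?_,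
    fun ξ => dyadicSum_cuspFilter, ?_, ?_, fun δ => not_ae_le_iSup_dyadicProduct_cuspFilter⟩
  · refine contDiffOn_const.congr fun x hx => cuspFilter_eq_one ?_
    simpa using (mem_ball_zero_iff.1 hx).le
  · exact ((hM.continuous_dyadicProduct continuous_cuspFilter (by norm_num)
      fun _ => cuspFilter_eq_one).comp (continuous_id.add continuous_const)).continuousOn
  · simpa using! dyadicSum_cuspFilter_third (n := 1) (by norm_num)
  · simpa using! dyadicSum_cuspFilter_third (n := 2) (by norm_num)
end

section
/- Suppose in addition that M is continuous on ℝ. Let ξ₀ ∈ [0,1] be a point with the 'sudden death' property: for every k ∈ ℤ there exists an integer N(k) ≥ 1 with M((ξ₀ + k)/2^{N(k)}) = 0. Then for every ε > 0 there exists η > 0 such that for every ξ with |ξ − ξ₀| < η and every k ∈ ℤ, one has P_ξ(k) ≤ ε; in particular sup_{k∈ℤ} P_ξ(k) ≤ ε on the whole neighborhood {ξ : |ξ − ξ₀| < η}. -/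
open MeasureTheory Filter Topology Finset

theorem Function.Periodic.uniformContinuous {f : ℝ → ℝ} {p : ℝ} (hp : 0 < p)
    (hf : Function.Periodic f p) (hc : Continuous f) : UniformContinuous f := by
  have : Fact (0 < p) := ⟨hp⟩
  have hlift : Continuous (hf.lift : AddCircle p → ℝ) := continuous_coinduced_dom.mpr hc
  have hmk : UniformContinuous (QuotientAddGroup.mk' (AddSubgroup.zmultiples p)) :=
    uniformContinuous_addMonoidHom_of_continuous (AddCircle.continuous_mk' p)
  exact (CompactSpace.uniformContinuous_of_continuous hlift).comp hmk

/-- if `M` is moreover continuous and `ξ₀ ∈ [0,1]` has the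
'sudden death' property (for every `k` some `N(k) ≥ 1` has
`M((ξ₀+k)/2^{N(k)}) = 0`), then for every `ε > 0` there is `η > 0` such that
`P_ξ(k) ≤ ε` for all `ξ` with `|ξ − ξ₀| < η` and all `k ∈ ℤ`. -/
theorem statement12 (M : ℝ → ℝ)
    (hM01 : ∀ ξ : ℝ, M ξ ∈ Set.Icc (0 : ℝ) 1)
    (hMcont : Continuous M)
    (hMper : ∀ ξ : ℝ, M (ξ + 1) = M ξ)
    (hMsum : ∀ ξ : ℝ, M ξ + M (ξ + 1 / 2) = 1)
    (hM0 : M 0 = 1)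
    (P : ℝ → ℤ → ℝ)
    (hP : ∀ (ξ : ℝ) (k : ℤ),
      Filter.Tendsto (fun N : ℕ => ∏ j ∈ Finset.range (N + 1), M ((ξ + (k : ℝ)) / 2 ^ (j + 1)))
        atTop (𝓝 (P ξ k)))
    (ξ₀ : ℝ) (hξ₀ : ξ₀ ∈ Set.Icc (0 : ℝ) 1)
    (hdeath : ∀ k : ℤ, ∃ N : ℕ, 1 ≤ N ∧ M ((ξ₀ + (k : ℝ)) / 2 ^ N) = 0) :
    ∀ ε > (0 : ℝ), ∃ η > (0 : ℝ), ∀ ξ : ℝ, |ξ - ξ₀| < η → ∀ k : ℤ, P ξ k ≤ ε := by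
  intro ε hε
  have hu : UniformContinuous M :=
    Function.Periodic.uniformContinuous one_pos hMper hMcont
  obtain ⟨η, hη, hclose⟩ := Metric.uniformContinuous_iff.mp hu ε hε
  refine ⟨η, hη, fun ξ hξ k => ?_⟩
  obtain ⟨n, hn, hzero⟩ := hdeath k
  have hdist : dist ((ξ + (k : ℝ)) / 2 ^ n) ((ξ₀ + (k : ℝ)) / 2 ^ n) < η := by
    rw [Real.dist_eq, ← sub_div, add_sub_add_right_eq_sub, abs_div,
      abs_of_pos (by positivity : (0 : ℝ) < 2 ^ n)]
    exact (div_le_self (abs_nonneg _) (one_le_pow₀ one_le_two)).trans_lt hξ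
  have hfactor : M ((ξ + (k : ℝ)) / 2 ^ n) ≤ ε := by
    have h := hclose hdist
    rw [hzero, Real.dist_eq, sub_zero] at h
    exact (le_abs_self _).trans h.le
  refine le_of_tendsto (hP ξ k) ?_
  filter_upwards [eventually_ge_atTop n] with N hN
  have hmem : n - 1 ∈ Finset.range (N + 1) := Finset.mem_range.mpr (by omega)
  rw [← Finset.mul_prod_erase _ _ hmem, Nat.sub_add_cancel hn]
  exact (mul_le_of_le_one_right (hM01 _).1
    (Finset.prod_le_one (fun _ _ => (hM01 _).1) fun _ _ => (hM01 _).2)).trans hfactor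
end

section
/- Define F(θ) = ∏_{j=1}^{∞} M(θ/2^j) for θ ∈ ℝ, and suppose that lim_{θ→0} F(θ) = 1 (for instance, this holds when F is continuous, since F(0) = 1). Then for every ξ₀ ∈ [0,1] and every k ∈ ℤ: P_{ξ₀}(k) = 0 if and only if there exists an integer N ≥ 1 with M((ξ₀ + k)/2^N) = 0. -/
open MeasureTheory Filter Topology Finset

/-- Splitting the first `N` factors off the infinite product `∏ M (θ / 2 ^ j)`. -/
theorem dyadicProduct_eq_prod_mul {M F : ℝ → ℝ}
    (hF : ∀ θ : ℝ, Tendsto (fun N : ℕ => ∏ j ∈ Finset.range N, M (θ / 2 ^ (j + 1)))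
      atTop (𝓝 (F θ))) (θ : ℝ) (N : ℕ) :
    F θ = (∏ j ∈ Finset.range N, M (θ / 2 ^ (j + 1))) * F (θ / 2 ^ N) := by
  have hshift := (hF θ).comp (tendsto_add_atTop_nat N)
  refine tendsto_nhds_unique hshift (((hF (θ / 2 ^ N)).const_mul _).congr fun n => ?_)
  rw [Function.comp_apply, add_comm n N, Finset.prod_range_add]
  congr 1
  refine Finset.prod_congr rfl fun j _ => ?_
  rw [div_div, ← pow_add, add_assoc]

theorem tendsto_div_two_pow (θ : ℝ) :
    Tendsto (fun N : ℕ => θ / 2 ^ N) atTop (𝓝 0) :=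
  tendsto_const_nhds.div_atTop (tendsto_pow_atTop_atTop_of_one_lt one_lt_two)

/-- An infinite product `F θ = ∏ M (θ / 2 ^ j)` with `F → 1` at `0` vanishes only through one of
its factors. -/
theorem dyadicProduct_eq_zero_iff {M F : ℝ → ℝ}
    (hF : ∀ θ : ℝ, Tendsto (fun N : ℕ => ∏ j ∈ Finset.range N, M (θ / 2 ^ (j + 1)))
      atTop (𝓝 (F θ)))
    (hFlim : Tendsto F (𝓝 0) (𝓝 1)) (θ : ℝ) :
    F θ = 0 ↔ ∃ N : ℕ, 1 ≤ N ∧ M (θ / 2 ^ N) = 0 := by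
  constructor
  · intro h
    obtain ⟨N, hN⟩ :=
      ((hFlim.comp (tendsto_div_two_pow θ)).eventually_ne one_ne_zero).exists
    rw [dyadicProduct_eq_prod_mul hF θ N] at h
    obtain ⟨j, -, hj⟩ := Finset.prod_eq_zero_iff.mp ((mul_eq_zero.mp h).resolve_right hN)
    exact ⟨j + 1, Nat.le_add_left 1 j, hj⟩
  · rintro ⟨N, hN, hzero⟩
    obtain ⟨n, rfl⟩ := Nat.exists_eq_add_of_le' hN
    rw [dyadicProduct_eq_prod_mul hF θ (n + 1),
      Finset.prod_eq_zero (Finset.self_mem_range_succ n) hzero, zero_mul]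

/-- with `F(θ) = ∏_{j=1}^∞ M(θ/2^j)` (so `P_ξ(k) = F(ξ+k)`) and
`lim_{θ→0} F(θ) = 1`, for every `ξ₀ ∈ [0,1]` and `k ∈ ℤ`:
`P_{ξ₀}(k) = 0` iff some `N ≥ 1` has `M((ξ₀+k)/2^N) = 0`. -/
theorem statement13 (M : ℝ → ℝ)
    (hM01 : ∀ ξ : ℝ, M ξ ∈ Set.Icc (0 : ℝ) 1)
    (hMmeas : Measurable M)
    (hMper : ∀ ξ : ℝ, M (ξ + 1) = M ξ)
    (hMsum : ∀ ξ : ℝ, M ξ + M (ξ + 1 / 2) = 1)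
    (hM0 : M 0 = 1)
    (F : ℝ → ℝ)
    (hF : ∀ θ : ℝ, Filter.Tendsto (fun N : ℕ => ∏ j ∈ Finset.range N, M (θ / 2 ^ (j + 1)))
      atTop (𝓝 (F θ)))
    (hFlim : Filter.Tendsto F (𝓝 (0 : ℝ)) (𝓝 (1 : ℝ))) :
    ∀ ξ₀ ∈ Set.Icc (0 : ℝ) 1, ∀ k : ℤ,
      (F (ξ₀ + (k : ℝ)) = 0 ↔ ∃ N : ℕ, 1 ≤ N ∧ M ((ξ₀ + (k : ℝ)) / 2 ^ N) = 0) := by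
  intro ξ₀ _ k
  exact dyadicProduct_eq_zero_iff hF hFlim _
end

section
/- (Strichartz) Let B : ℝ^d → ℝ^d be a linear map with B(ℤ^d) ⊆ ℤ^d, and suppose B is a similarity: there exists c > 1 + √d such that ‖Bx‖ = c‖x‖ for all x ∈ ℝ^d (Euclidean norm). Let R = ℤ^d ∩ B((−1/2, 1/2]^d). Then: (i) R is a complete set of coset representatives for the quotient group ℤ^d / B(ℤ^d); and (ii) every k ∈ ℤ^d admits a finite expansion k = r_0 + B r_1 + B² r_2 + ⋯ + B^n r_n with r_0, …, r_n ∈ R. -/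
open Finset

theorem exists_integer_vector_sub_mem_Ioc {ι : Type*} [Fintype ι] (x : EuclideanSpace ℝ ι) :
    ∃ m : EuclideanSpace ℝ ι, (∀ i, ∃ n : ℤ, m i = (n : ℝ)) ∧
      ∀ i, (x - m) i ∈ Set.Ioc (-(1 / 2) : ℝ) (1 / 2) := by
  refine ⟨WithLp.toLp 2 fun i => (⌈x i - 1 / 2⌉ : ℝ), fun i => ⟨_, rfl⟩, fun i => ?_⟩
  have h₁ := Int.le_ceil (x i - 1 / 2)
  have h₂ := Int.ceil_lt_add_one (x i - 1 / 2)
  simp only [PiLp.sub_apply, Set.mem_Ioc]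
  constructor <;> linarith

theorem norm_le_of_forall_mem_Ioc {d : ℕ} {y : EuclideanSpace ℝ (Fin d)}
    (hy : ∀ i, y i ∈ Set.Ioc (-(1 / 2) : ℝ) (1 / 2)) : ‖y‖ ≤ √d / 2 := by
  refine le_of_sq_le_sq ?_ (by positivity)
  rw [EuclideanSpace.real_norm_sq_eq, div_pow, Real.sq_sqrt (Nat.cast_nonneg d)]
  calc ∑ i, y i ^ 2 ≤ ∑ _i : Fin d, (1 / 4 : ℝ) :=
        Finset.sum_le_sum fun i _ => by nlinarith [(hy i).1, (hy i).2]
    _ = (d : ℝ) / 2 ^ 2 := by simp; ring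

theorem forall_mem_Ioc_of_norm_lt {ι : Type*} [Fintype ι] {y : EuclideanSpace ℝ ι}
    (hy : ‖y‖ < 1 / 2) (i : ι) : y i ∈ Set.Ioc (-(1 / 2) : ℝ) (1 / 2) := by
  have h := abs_lt.1 ((PiLp.norm_apply_le y i).trans_lt hy)
  exact ⟨h.1, h.2.le⟩

theorem eq_of_forall_mem_Ioc_of_integer_sub {ι : Type*} [Fintype ι]
    {y z : EuclideanSpace ℝ ι}
    (hy : ∀ i, y i ∈ Set.Ioc (-(1 / 2) : ℝ) (1 / 2))
    (hz : ∀ i, z i ∈ Set.Ioc (-(1 / 2) : ℝ) (1 / 2))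
    (h : ∀ i, ∃ n : ℤ, (y - z) i = (n : ℝ)) : y = z := by
  ext i
  obtain ⟨n, hn⟩ := h i
  rw [PiLp.sub_apply] at hn
  have h₁ : (n : ℝ) < 1 := by linarith [(hy i).2, (hz i).1]
  have h₂ : (-1 : ℝ) < n := by linarith [(hy i).1, (hz i).2]
  have h₀ : n = 0 := by
    have h₁' : n < 1 := by exact_mod_cast h₁
    have h₂' : -1 < n := by exact_mod_cast h₂
    omega
  rw [h₀, Int.cast_zero] at hn
  linarith

/-- Strichartz's lemma: for a linear similarity `B` of ratio
`c > 1 + √d` mapping the integer lattice `L = ℤ^d` into itself, the set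
`R = ℤ^d ∩ B((−1/2,1/2]^d)` is a complete set of coset representatives for
`ℤ^d / B(ℤ^d)`, and every lattice point has a finite expansion
`k = r₀ + B r₁ + ⋯ + Bⁿ rₙ` with all `rⱼ ∈ R`. -/
theorem statement17 (d : ℕ)
    (B : EuclideanSpace ℝ (Fin d) →ₗ[ℝ] EuclideanSpace ℝ (Fin d))
    (L : Set (EuclideanSpace ℝ (Fin d)))
    (hL : L = {x : EuclideanSpace ℝ (Fin d) | ∀ i : Fin d, ∃ n : ℤ, x i = (n : ℝ)})
    (hBL : ∀ x ∈ L, B x ∈ L)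
    (c : ℝ) (hc : 1 + Real.sqrt d < c)
    (hsim : ∀ x : EuclideanSpace ℝ (Fin d), ‖B x‖ = c * ‖x‖)
    (R : Set (EuclideanSpace ℝ (Fin d)))
    (hR : R = L ∩ (⇑B '' {x : EuclideanSpace ℝ (Fin d) |
      ∀ i : Fin d, x i ∈ Set.Ioc (-(1 / 2) : ℝ) (1 / 2)})) :
    (∀ k ∈ L, ∃! r : EuclideanSpace ℝ (Fin d), r ∈ R ∧ k - r ∈ ⇑B '' L) ∧
    (∀ k ∈ L, ∃ (n : ℕ) (r : ℕ → EuclideanSpace ℝ (Fin d)),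
      (∀ j ≤ n, r j ∈ R) ∧ k = ∑ j ∈ Finset.range (n + 1), (B ^ j) (r j)) := by
  have hc₁ : 1 < c := by linarith [Real.sqrt_nonneg (d : ℝ)]
  have hc₀ : 0 < c := by linarith
  have hinj : Function.Injective B := by
    refine (injective_iff_map_eq_zero B).2 fun x hx => ?_
    have h := hsim x
    rw [hx, norm_zero] at h
    exact norm_eq_zero.1 ((mul_eq_zero.1 h.symm).resolve_left hc₀.ne')
  have hsurj : Function.Surjective B := LinearMap.injective_iff_surjective.1 hinj
  have hsub : ∀ x ∈ L, ∀ y ∈ L, x - y ∈ L := by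
    subst hL
    intro x hx y hy i
    obtain ⟨m, hm⟩ := hx i
    obtain ⟨n, hn⟩ := hy i
    exact ⟨m - n, by rw [PiLp.sub_apply, hm, hn, Int.cast_sub]⟩
  have hdiv : ∀ k ∈ L, ∃ m ∈ L, k - B m ∈ R ∧ ‖m‖ ≤ ‖k‖ / c + √d / 2 := by
    intro k hk
    obtain ⟨x, rfl⟩ := hsurj k
    obtain ⟨m, hm, hxm⟩ := exists_integer_vector_sub_mem_Ioc x
    have hmL : m ∈ L := hL ▸ hm
    refine ⟨m, hmL, hR ▸ ⟨hsub _ hk _ (hBL m hmL), x - m, hxm, map_sub B x m⟩, ?_⟩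
    rw [hsim, mul_div_cancel_left₀ _ hc₀.ne']
    have h₁ := norm_le_of_forall_mem_Ioc hxm
    have h₂ := norm_sub_le x (x - m)
    rw [sub_sub_cancel] at h₂
    linarith
  refine ⟨fun k hk => ?_, fun k hk => ?_⟩
  · obtain ⟨m, hm, hr, -⟩ := hdiv k hk
    refine ⟨k - B m, ⟨hr, m, hm, (sub_sub_cancel _ _).symm⟩, ?_⟩
    rintro s ⟨hs, a, ha, has⟩
    rw [hR] at hr hs
    obtain ⟨-, y, hy, hyr⟩ := hr
    obtain ⟨-, z, hz, rfl⟩ := hs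
    have hzy : z - y = m - a := hinj <| by
      rw [map_sub, map_sub, hyr, has]
      abel
    have hint : z - y ∈ L := hzy ▸ hsub m hm a ha
    rw [hL] at hint
    rw [← hyr, eq_of_forall_mem_Ioc_of_integer_sub hz hy hint]
  · have key : ∀ (N : ℕ), ∀ k ∈ L, ‖k‖ < c / 2 + N * ((c - 1 - √d) / 2) →
        ∃ (n : ℕ) (r : ℕ → EuclideanSpace ℝ (Fin d)),
          (∀ j ≤ n, r j ∈ R) ∧ k = ∑ j ∈ Finset.range (n + 1), (B ^ j) (r j) := by
      have small : ∀ k ∈ L, ‖k‖ < c / 2 → ∃ (n : ℕ) (r : ℕ → EuclideanSpace ℝ (Fin d)),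
          (∀ j ≤ n, r j ∈ R) ∧ k = ∑ j ∈ Finset.range (n + 1), (B ^ j) (r j) := by
        intro k hk hlt
        refine ⟨0, fun _ => k, fun _ _ => ?_, by simp⟩
        obtain ⟨x, rfl⟩ := hsurj k
        rw [hsim] at hlt
        exact hR ▸ ⟨hk, x, forall_mem_Ioc_of_norm_lt (by nlinarith), rfl⟩
      intro N
      induction N with
      | zero => simpa using small
      | succ N ih =>
        intro k hk hlt
        obtain hk' | hk' := lt_or_ge ‖k‖ (c / 2)
        · exact small k hk hk'
        obtain ⟨m, hm, hr, hmk⟩ := hdiv k hk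
        have hdec : ‖k‖ / c + √d / 2 ≤ ‖k‖ - (c - 1 - √d) / 2 := by
          have h : 1 / 2 ≤ ‖k‖ / c := by
            rw [le_div_iff₀ hc₀]
            linarith
          have hkc : ‖k‖ = ‖k‖ / c * c := (div_mul_cancel₀ _ hc₀.ne').symm
          nlinarith
        push_cast at hlt
        obtain ⟨n, r, hrR, hsum⟩ := ih m hm (by linarith)
        refine ⟨n + 1, fun j => j.casesOn (k - B m) r, ?_, ?_⟩
        · rintro (_ | j) hj
          · exact hr
          · exact hrR j (by omega)
        · rw [Finset.sum_range_succ']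
          simp only [pow_succ', Module.End.mul_apply, pow_zero, Module.End.one_apply]
          rw [← map_sum, ← hsum]
          exact (add_sub_cancel (B m) k).symm
    obtain ⟨N, hN⟩ := exists_nat_gt (‖k‖ / ((c - 1 - √d) / 2))
    rw [div_lt_iff₀ (by linarith)] at hN
    exact key N k hk (by linarith)
end

section
/- (Strichartz) Let B : ℝ^d → ℝ^d be a linear map with B(ℤ^d) ⊆ ℤ^d, suppose there exists c > 1 + √d with ‖Bx‖ = c‖x‖ for all x ∈ ℝ^d, and let R = ℤ^d ∩ B((−1/2, 1/2]^d). Define T = { ∑_{j=1}^{∞} B^{−j} a_j : a_j ∈ R for all j ≥ 1 } (each such series converges absolutely in ℝ^d). Then T satisfies the self-affine set equation B(T) = ⋃_{r∈R} (T + r), and T tiles ℝ^d by integer translates: ⋃_{k∈ℤ^d} (T + k) = ℝ^d, and for all k ≠ j in ℤ^d the Lebesgue measure of (T + k) ∩ (T + j) is zero. -/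
open Finset MeasureTheory

section Tile

variable {E : Type*} [NormedAddCommGroup E] [NormedSpace ℝ E]

/-- The set of all sums `∑_{j ≥ 1} B^{-j} a_j` with digits `a_j ∈ R`. -/
def digitTile (B : E ≃ₗ[ℝ] E) (R : Set E) : Set E :=
  {x | ∃ a : ℕ → E, (∀ j : ℕ, a j ∈ R) ∧ HasSum (fun j : ℕ => (B.symm ^ (j + 1)) (a j)) x}

theorem zero_mem_digitTile {B : E ≃ₗ[ℝ] E} {R : Set E} (h : (0 : E) ∈ R) :
    (0 : E) ∈ digitTile B R :=
  ⟨0, fun _ => h, by simp⟩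

theorem apply_symm_pow_succ (B : E ≃ₗ[ℝ] E) (n : ℕ) (x : E) :
    B ((B.symm ^ (n + 1)) x) = (B.symm ^ n) x := by
  rw [pow_succ', LinearEquiv.mul_apply, LinearEquiv.apply_symm_apply]

theorem symm_apply_pow (B : E ≃ₗ[ℝ] E) (n : ℕ) (x : E) :
    B.symm ((B.symm ^ n) x) = (B.symm ^ (n + 1)) x := by
  rw [pow_succ', LinearEquiv.mul_apply]

theorem image_digitTile [FiniteDimensional ℝ E] (B : E ≃ₗ[ℝ] E) (R : Set E) :
    B '' digitTile B R = ⋃ r ∈ R, (fun t => t + r) '' digitTile B R := by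
  ext x
  simp only [Set.mem_iUnion, Set.mem_image, exists_prop]
  constructor
  · rintro ⟨t, ⟨a, ha, hs⟩, rfl⟩
    have h := hs.map B.toContinuousLinearEquiv B.toContinuousLinearEquiv.continuous
    simp only [Function.comp_def, LinearEquiv.coe_toContinuousLinearEquiv',
      apply_symm_pow_succ] at h
    rw [← hasSum_nat_add_iff' 1] at h
    exact ⟨a 0, ha 0, B t - a 0, ⟨fun j => a (j + 1), fun j => ha _, by simpa using h⟩,
      sub_add_cancel _ _⟩
  · rintro ⟨r, hr, t, ⟨a, ha, hs⟩, rfl⟩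
    refine ⟨B.symm (t + r), ⟨fun j => Nat.casesOn j r a, ?_, ?_⟩, B.apply_symm_apply _⟩
    · rintro (_ | j)
      exacts [hr, ha j]
    · have h : HasSum (fun j : ℕ => (B.symm ^ j) (Nat.casesOn j r a : E)) (t + r) := by
        rw [← hasSum_nat_add_iff' 1]
        simpa using hs
      have h' := h.map B.symm.toContinuousLinearEquiv B.symm.toContinuousLinearEquiv.continuous
      simpa only [Function.comp_def, LinearEquiv.coe_toContinuousLinearEquiv',
        symm_apply_pow] using h'

theorem norm_symm_pow {B : E ≃ₗ[ℝ] E} {c : ℝ} (hc : 0 < c) (hsim : ∀ x, ‖B x‖ = c * ‖x‖)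
    (n : ℕ) (x : E) : ‖(B.symm ^ n) x‖ = c⁻¹ ^ n * ‖x‖ := by
  induction n with
  | zero => simp
  | succ n ih =>
    have h := hsim ((B.symm ^ (n + 1)) x)
    rw [apply_symm_pow_succ, ih] at h
    rw [pow_succ' c⁻¹, mul_assoc, h, inv_mul_cancel_left₀ hc.ne']

theorem isCompact_digitTile [FiniteDimensional ℝ E] {B : E ≃ₗ[ℝ] E} {c : ℝ} (hc : 1 < c)
    (hsim : ∀ x, ‖B x‖ = c * ‖x‖) {R : Set E} (hR : R.Finite) :
    IsCompact (digitTile B R) := by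
  have hc0 : 0 < c := one_pos.trans hc
  have : CompactSpace R := isCompact_iff_compactSpace.1 hR.isCompact
  obtain ⟨M, hM⟩ := hR.isBounded.exists_norm_le
  have hle : ∀ (n : ℕ) (x : R), ‖(B.symm ^ (n + 1)) (x : E)‖ ≤ c⁻¹ ^ (n + 1) * M := fun n x => by
    rw [norm_symm_pow hc0 hsim]
    gcongr
    exact hM x x.2
  have hsum : Summable fun n : ℕ => c⁻¹ ^ (n + 1) * M :=
    ((summable_nat_add_iff 1).2 (summable_geometric_of_lt_one (inv_nonneg.2 hc0.le)
      (inv_lt_one_of_one_lt₀ hc))).mul_right M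
  have : CompleteSpace E := FiniteDimensional.complete ℝ E
  have hcont : Continuous fun a : ℕ → R => ∑' j, (B.symm ^ (j + 1)) (a j : E) :=
    continuous_tsum (fun j => ((B.symm ^ (j + 1)).toContinuousLinearEquiv.continuous).comp
      (continuous_subtype_val.comp (continuous_apply j))) hsum fun n a => hle n (a n)
  convert! isCompact_range hcont
  ext x
  constructor
  · rintro ⟨a, ha, hs⟩
    exact ⟨fun j => ⟨a j, ha j⟩, hs.tsum_eq⟩
  · rintro ⟨a, rfl⟩
    exact ⟨fun j => a j, fun j => (a j).2,
      (Summable.of_norm_bounded hsum fun n => hle n (a n)).hasSum⟩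

/-- If every element of `L` is of the form `B l' + r` with `l' ∈ L` and a digit `r`, then the
translates of the tile by `L` cover the space. -/
theorem iUnion_digitTile_eq_univ [FiniteDimensional ℝ E] {B : E ≃ₗ[ℝ] E} {c : ℝ} (hc : 1 < c)
    (hsim : ∀ x, ‖B x‖ = c * ‖x‖) {R : Set E} (hR : R.Finite) (hR0 : (0 : E) ∈ R)
    {L : AddSubgroup E} (hL : IsClosed (L : Set E))
    (hdiv : ∀ l ∈ L, ∃ l' ∈ L, l - B l' ∈ R)
    {M : ℝ} (hround : ∀ x, ∃ l ∈ L, ‖x - l‖ ≤ M) :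
    (⋃ k ∈ (L : Set E), (fun t => t + k) '' digitTile B R) = Set.univ := by
  have hc0 : 0 < c := one_pos.trans hc
  set S := ⋃ k ∈ (L : Set E), (fun t => t + k) '' digitTile B R with hS
  have hmem : ∀ x, x ∈ S ↔ ∃ k ∈ L, ∃ t ∈ digitTile B R, t + k = x := fun x => by
    simp only [hS, Set.mem_iUnion, Set.mem_image, SetLike.mem_coe, exists_prop]
  have hclosed : IsClosed S := by
    have h := hL.add_right_of_isCompact (isCompact_digitTile hc hsim hR)
    convert! h using 1
    ext x
    simp only [hmem, Set.mem_add, SetLike.mem_coe, add_comm]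
  have hsymm : ∀ x ∈ S, B.symm x ∈ S := fun x hx => by
    obtain ⟨k, hk, t, ht, rfl⟩ := (hmem x).1 hx
    obtain ⟨l, hl, hr⟩ := hdiv k hk
    have h : t + (k - B l) ∈ B '' digitTile B R := by
      rw [image_digitTile]
      exact Set.mem_biUnion hr ⟨t, ht, rfl⟩
    obtain ⟨t', ht', hB⟩ := h
    refine (hmem _).2 ⟨l, hl, t', ht', B.injective ?_⟩
    rw [map_add, hB, B.apply_symm_apply]
    abel
  have hpow : ∀ n : ℕ, ∀ x ∈ S, (B.symm ^ n) x ∈ S := fun n x hx => by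
    induction n with
    | zero => simpa using hx
    | succ n ih => simpa only [symm_apply_pow] using hsymm _ ih
  have hLS : ∀ l ∈ L, l ∈ S := fun l hl =>
    (hmem l).2 ⟨l, hl, 0, zero_mem_digitTile hR0, zero_add l⟩
  refine Set.eq_univ_of_forall fun x => ?_
  choose f hfL hf using fun n : ℕ => hround ((B ^ n) x)
  have hinv : ∀ n : ℕ, (B.symm ^ n) ((B ^ n) x) = x := fun n => by
    have : (B.symm ^ n) * (B ^ n) = 1 := by
      have h : B.symm = B⁻¹ := rfl
      rw [h, inv_pow, inv_mul_cancel]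
    rw [← LinearEquiv.mul_apply, this, LinearEquiv.coe_one, id]
  refine hclosed.mem_of_tendsto (f := fun n : ℕ => (B.symm ^ n) (f n)) (b := Filter.atTop) ?_
    (Filter.Eventually.of_forall fun n => hpow n _ (hLS _ (hfL n)))
  rw [tendsto_iff_norm_sub_tendsto_zero]
  have hlim : Filter.Tendsto (fun n : ℕ => c⁻¹ ^ n * M) Filter.atTop (nhds 0) := by
    simpa using (tendsto_pow_atTop_nhds_zero_of_lt_one (inv_nonneg.2 hc0.le)
      (inv_lt_one_of_one_lt₀ hc)).mul_const M
  refine squeeze_zero (fun _ => norm_nonneg _) (fun n => ?_) hlim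
  nth_rw 1 [← hinv n]
  rw [← map_sub, norm_symm_pow hc0 hsim, norm_sub_rev]
  gcongr
  exact hf n

end Tile

section Measure

/-- Finitely many measurable sets of equal finite measure whose union has full measure are pairwise
almost disjoint. -/
theorem measure_inter_eq_zero_of_card_mul_le {α ι : Type*} [MeasurableSpace α] {μ : Measure α}
    (s : Finset ι) (A : ι → Set α) (hA : ∀ i ∈ s, MeasurableSet (A i)) {v : ENNReal}
    (hv : v ≠ ⊤) (hAv : ∀ i ∈ s, μ (A i) = v) (hU : s.card * v ≤ μ (⋃ i ∈ s, A i))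
    {i j : ι} (hi : i ∈ s) (hj : j ∈ s) (hij : i ≠ j) : μ (A i ∩ A j) = 0 := by
  classical
  have hsub : (⋃ k ∈ s, A k) ⊆ (⋃ k ∈ s.erase j, A k) ∪ A j \ A i := by
    intro x hx
    simp only [Set.mem_iUnion, exists_prop] at hx
    obtain ⟨k, hk, hxk⟩ := hx
    by_cases hxi : x ∈ A i
    · exact Or.inl (Set.mem_biUnion (Finset.mem_erase.2 ⟨hij, hi⟩) hxi)
    · by_cases hkj : k = j
      · exact Or.inr ⟨hkj ▸ hxk, hxi⟩
      · exact Or.inl (Set.mem_biUnion (Finset.mem_erase.2 ⟨hkj, hk⟩) hxk)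
  have h₁ : μ (⋃ k ∈ s.erase j, A k) ≤ (s.erase j).card * v := by
    refine (measure_biUnion_finset_le _ _).trans (le_of_eq ?_)
    rw [Finset.sum_congr rfl fun k hk => hAv k (Finset.mem_of_mem_erase hk), Finset.sum_const,
      nsmul_eq_mul]
  have h₂ : μ (A j ∩ A i) + μ (A j \ A i) = v := by
    rw [measure_inter_add_sdiff _ (hA i hi), hAv j hj]
  have hcard : (s.card : ENNReal) * v = (s.erase j).card * v + v := by
    rw [← Finset.card_erase_add_one hj]
    push_cast
    ring
  have hle : s.card * v + μ (A j ∩ A i) ≤ s.card * v + 0 := by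
    calc s.card * v + μ (A j ∩ A i)
        ≤ ((s.erase j).card * v + μ (A j \ A i)) + μ (A j ∩ A i) := by
          gcongr
          exact hU.trans ((measure_mono hsub).trans ((measure_union_le _ _).trans (by gcongr)))
      _ = s.card * v + 0 := by
          rw [add_assoc, add_comm (μ (A j \ A i)), h₂, hcard, add_zero]
  rw [ENNReal.add_le_add_iff_left (ENNReal.mul_ne_top (ENNReal.natCast_ne_top _) hv)] at hle
  rw [Set.inter_comm]
  exact le_antisymm hle zero_le

variable {E : Type*} [NormedAddCommGroup E] [NormedSpace ℝ E] [FiniteDimensional ℝ E]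
  [MeasurableSpace E] [BorelSpace E] (μ : Measure E) [μ.IsAddHaarMeasure]

/-- The number of lattice points in the image under `B` of a transversal of the lattice is at most
`|det B|`. -/
theorem card_le_abs_det {B : E ≃ₗ[ℝ] E} {L : AddSubgroup E} [Countable L]
    (hBL : ∀ x ∈ L, B x ∈ L) {Q : Set E} (hQ : MeasurableSet Q) (hQ0 : μ Q ≠ 0)
    (hQtop : μ Q ≠ ⊤) (hround : ∀ x, ∃ l ∈ L, x - l ∈ Q)
    (huniq : ∀ x ∈ Q, ∀ y ∈ Q, x - y ∈ L → x = y)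
    (s : Finset E) (hs : (s : Set E) ⊆ (L : Set E) ∩ B '' Q) :
    (s.card : ENNReal) ≤ ENNReal.ofReal |LinearMap.det (B : E →ₗ[ℝ] E)| := by
  have hBQ : MeasurableSet (B '' Q) :=
    B.toContinuousLinearEquiv.toHomeomorph.measurableEmbedding.measurableSet_image.2 hQ
  have hmeas : ∀ r : E, MeasurableSet ((fun x => x + r) '' Q) := fun r =>
    (measurableEmbedding_addRight r).measurableSet_image.2 hQ
  let G : AddSubgroup E := L.map (B : E →ₗ[ℝ] E).toAddMonoidHom
  have : Countable G := by
    have : (G : Set E) = B '' (L : Set E) := rfl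
    exact ((Set.to_countable (L : Set E)).image B).to_subtype
  have hfund : IsAddFundamentalDomain G (B '' Q) μ := by
    refine IsAddFundamentalDomain.mk' hBQ.nullMeasurableSet fun x => ?_
    obtain ⟨l, hl, hq⟩ := hround (B.symm x)
    refine ⟨⟨-B l, neg_mem ⟨l, hl, rfl⟩⟩, ⟨_, hq, ?_⟩, ?_⟩
    · simp [AddSubgroup.vadd_def, sub_eq_neg_add]
    · rintro ⟨_, m, hm, rfl⟩ ⟨q, hq', hqm⟩
      have hqm : q = m + B.symm x := B.injective (by
        simpa [AddSubgroup.vadd_def] using hqm)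
      have hmem : B.symm x - l - q ∈ L := by
        have h : B.symm x - l - q = -(l + m) := by
          rw [hqm]
          abel
        exact h ▸ neg_mem (add_mem hl hm)
      have hlm : m = -l := by
        have h := huniq _ hq _ hq' hmem
        rw [hqm, sub_eq_neg_add] at h
        exact (add_right_cancel h).symm
      exact Subtype.ext (by simp [hlm])
  have hdisj : Set.PairwiseDisjoint (s : Set E) fun r => (fun x => x + r) '' Q := by
    intro r hr r' hr' hne
    refine Set.disjoint_left.2 ?_
    rintro _ ⟨q, hq, rfl⟩ ⟨q', hq', h⟩
    have h : q' + r' = q + r := h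
    have hsub : q' - q = r - r' := by rw [sub_eq_sub_iff_add_eq_add, h, add_comm]
    have hqq := huniq q' hq' q hq (hsub ▸ sub_mem (hs hr).1 (hs hr').1)
    rw [hqq, sub_self] at hsub
    exact hne (sub_eq_zero.1 hsub.symm)
  have hvol : μ (⋃ r ∈ s, (fun x => x + r) '' Q) = s.card * μ Q := by
    rw [measure_biUnion_finset hdisj fun r _ => hmeas r]
    simp
  have hle : μ (⋃ r ∈ s, (fun x => x + r) '' Q) ≤ μ (B '' Q) := by
    by_contra! hlt
    obtain ⟨x, hx, y, hy, ⟨_, l, hl, rfl⟩, hg, hxy⟩ :=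
      hfund.exists_ne_zero_vadd_eq
        (Finset.measurableSet_biUnion _ fun r _ => hmeas r).nullMeasurableSet hlt
    simp only [Set.mem_iUnion, exists_prop] at hx hy
    obtain ⟨r, hr, q, hq, rfl⟩ := hx
    obtain ⟨r', hr', q', hq', rfl⟩ := hy
    have hxy : B l + (q + r) = q' + r' := hxy
    obtain ⟨hrL, p, hp, rfl⟩ := hs hr
    obtain ⟨hrL', p', hp', rfl⟩ := hs hr'
    have hsub : q' - q = B l + B p - B p' := by
      rw [sub_eq_sub_iff_add_eq_add, ← hxy]
      abel
    have hqq := huniq q' hq' q hq (hsub ▸ sub_mem (add_mem (hBL l hl) hrL) hrL')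
    rw [hqq, sub_self, ← map_add, ← map_sub, eq_comm, LinearEquiv.map_eq_zero_iff] at hsub
    have hpp : p' - p = l := by
      rw [sub_eq_zero] at hsub
      rw [← hsub, add_sub_cancel_right]
    have := huniq p' hp' p hp (hpp ▸ hl)
    rw [this, sub_self] at hpp
    exact hg (Subtype.ext (by simp [← hpp]))
  have himage : μ (B '' Q) = ENNReal.ofReal |LinearMap.det (B : E →ₗ[ℝ] E)| * μ Q :=
    μ.addHaar_image_linearMap (B : E →ₗ[ℝ] E) Q
  rw [hvol, himage] at hle
  exact (ENNReal.mul_le_mul_iff_left hQ0 hQtop).1 hle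

/-- Distinct translates of the tile by digits overlap in a null set as soon as there are at most
`|det B|` digits. -/
theorem measure_digitTile_inter_eq_zero {B : E ≃ₗ[ℝ] E} {s : Finset E}
    (hT : IsCompact (digitTile B (s : Set E)))
    (hcard : (s.card : ENNReal) ≤ ENNReal.ofReal |LinearMap.det (B : E →ₗ[ℝ] E)|)
    {r r' : E} (hr : r ∈ s) (hr' : r' ∈ s) (hne : r ≠ r') :
    μ ((fun t => t + r) '' digitTile B s ∩ (fun t => t + r') '' digitTile B s) = 0 := by
  refine measure_inter_eq_zero_of_card_mul_le s (fun r => (fun t => t + r) '' digitTile B s)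
    (fun r _ => (measurableEmbedding_addRight r).measurableSet_image.2 hT.measurableSet)
    (v := μ (digitTile B s)) hT.measure_lt_top.ne (fun r _ => by simp) ?_ hr hr' hne
  have himage : μ (B '' digitTile B s) = _ :=
    μ.addHaar_image_linearMap (B : E →ₗ[ℝ] E) (digitTile B s)
  have h := image_digitTile B (s : Set E)
  simp only [Finset.mem_coe] at h
  rw [← h, himage]
  gcongr

/-- Distinct lattice translates of the tile overlap in a null set when repeated division with
remainder by `B` brings every lattice point to `0`. -/
theorem measure_translates_inter_eq_zero {B : E ≃ₗ[ℝ] E} {s : Finset E}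
    (hT : IsCompact (digitTile B (s : Set E)))
    (hcard : (s.card : ENNReal) ≤ ENNReal.ofReal |LinearMap.det (B : E →ₗ[ℝ] E)|)
    {L : AddSubgroup E} {δ : ℝ}
    (hδ : 0 < δ) (hdiv : ∀ l ∈ L, ∃ l' ∈ L, l - B l' ∈ s ∧ (l' = 0 ∨ ‖l'‖ ≤ ‖l‖ - δ))
    {k j : E} (hk : k ∈ L) (hj : j ∈ L) (hkj : k ≠ j) :
    μ ((fun t => t + k) '' digitTile B s ∩ (fun t => t + j) '' digitTile B s) = 0 := by
  have hmain : ∀ n : ℕ, ∀ k ∈ L, ∀ j ∈ L, k ≠ j → ‖k‖ ≤ n * δ → ‖j‖ ≤ n * δ →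
      μ ((fun t => t + k) '' digitTile B s ∩ (fun t => t + j) '' digitTile B s) = 0 := by
    intro n
    induction n with
    | zero =>
      intro k _ j _ hkj hkn hjn
      rw [Nat.cast_zero, zero_mul, norm_le_zero_iff] at hkn hjn
      exact absurd (hkn.trans hjn.symm) hkj
    | succ n ih =>
      intro k hk j hj hkj hkn hjn
      have hstep : ∀ l ∈ L, ‖l‖ ≤ (n + 1 : ℕ) * δ → ∃ l' ∈ L, l - B l' ∈ s ∧ ‖l'‖ ≤ n * δ := by
        intro l hl hln
        obtain ⟨l', hl', hls, h⟩ := hdiv l hl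
        refine ⟨l', hl', hls, ?_⟩
        rcases h with rfl | h
        · rw [norm_zero]
          positivity
        · push_cast at hln
          linarith
      obtain ⟨k', hk', hks, hkn'⟩ := hstep k hk hkn
      obtain ⟨j', hj', hjs, hjn'⟩ := hstep j hj hjn
      by_cases h : k' = j'
      · subst h
        have hnull := measure_digitTile_inter_eq_zero μ hT hcard hks hjs
          (fun h => hkj (sub_left_injective h))
        rw [← measure_preimage_add_right μ (-B k')] at hnull
        refine measure_mono_null ?_ hnull
        rintro _ ⟨⟨t, ht, rfl⟩, ⟨t', ht', htt⟩⟩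
        refine ⟨⟨t, ht, ?_⟩, ⟨t', ht', ?_⟩⟩
        · simp only
          abel
        · rw [← htt]
          simp only
          abel
      · have hnull := ih k' hk' j' hj' h hkn' hjn'
        have hB := μ.addHaar_image_linearMap (B : E →ₗ[ℝ] E)
          ((fun t => t + k') '' digitTile B s ∩ (fun t => t + j') '' digitTile B s)
        rw [hnull, mul_zero] at hB
        refine measure_mono_null ?_ hB
        have hsub : ∀ l l' : E, l - B l' ∈ s → ∀ x ∈ (fun t => t + l) '' digitTile B s,
            B.symm x ∈ (fun t => t + l') '' digitTile B s := by
          rintro l l' hl _ ⟨t, ht, rfl⟩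
          have h : t + (l - B l') ∈ B '' digitTile B s := by
            rw [image_digitTile]
            exact Set.mem_biUnion hl ⟨t, ht, rfl⟩
          obtain ⟨t', ht', h⟩ := h
          refine ⟨t', ht', B.injective ?_⟩
          simp only [map_add, h, B.apply_symm_apply]
          abel
        exact fun x hx => ⟨B.symm x, ⟨hsub k k' hks x hx.1, hsub j j' hjs x hx.2⟩,
          B.apply_symm_apply x⟩
  obtain ⟨n, hn⟩ := exists_nat_ge (max ‖k‖ ‖j‖ / δ)
  rw [div_le_iff₀ hδ] at hn
  exact hmain n k hk j hj hkj ((le_max_left _ _).trans hn) ((le_max_right _ _).trans hn)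

end Measure

section Lattice

/-- The integer lattice `ℤ^d` in `ℝ^d`. -/
def intLattice (d : ℕ) : AddSubgroup (EuclideanSpace ℝ (Fin d)) where
  carrier := {x | ∀ i : Fin d, ∃ n : ℤ, x i = (n : ℝ)}
  zero_mem' _ := ⟨0, by simp⟩
  add_mem' hx hy i := by
    obtain ⟨m, hm⟩ := hx i
    obtain ⟨n, hn⟩ := hy i
    exact ⟨m + n, by simp [hm, hn]⟩
  neg_mem' hx i := by
    obtain ⟨m, hm⟩ := hx i
    exact ⟨-m, by simp [hm]⟩

/-- The half-open unit cube `(-1/2, 1/2]^d`. -/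
def halfOpenCube (d : ℕ) : Set (EuclideanSpace ℝ (Fin d)) :=
  {x | ∀ i : Fin d, x i ∈ Set.Ioc (-(1 / 2) : ℝ) (1 / 2)}

variable {d : ℕ}

theorem intLattice_subset_range :
    (intLattice d : Set (EuclideanSpace ℝ (Fin d))) ⊆
      Set.range fun n : Fin d → ℤ => WithLp.toLp 2 fun i => (n i : ℝ) := by
  intro x hx
  choose n hn using hx
  exact ⟨n, by ext i; simp [hn]⟩

instance : Countable (intLattice d) :=
  ((Set.countable_range _).mono intLattice_subset_range).to_subtype

theorem isClosed_intLattice : IsClosed (intLattice d : Set (EuclideanSpace ℝ (Fin d))) := by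
  have h : (intLattice d : Set (EuclideanSpace ℝ (Fin d))) =
      ⋂ i : Fin d, (fun x => x i) ⁻¹' Set.range ((↑) : ℤ → ℝ) := by
    ext x
    simp [intLattice, eq_comm]
  rw [h]
  exact isClosed_iInter fun i => Real.isClosed_range_intCast.preimage (by fun_prop)

theorem finite_intLattice_inter_of_norm_le {s : Set (EuclideanSpace ℝ (Fin d))} {M : ℝ}
    (hs : ∀ x ∈ s, ‖x‖ ≤ M) :
    ((intLattice d : Set (EuclideanSpace ℝ (Fin d))) ∩ s).Finite := by
  refine ((Set.finite_Icc (fun _ : Fin d => -⌈M⌉) fun _ => ⌈M⌉).image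
    fun n : Fin d → ℤ => (WithLp.toLp 2 fun i => (n i : ℝ))).subset ?_
  rintro x ⟨hx, hxs⟩
  obtain ⟨n, rfl⟩ := intLattice_subset_range hx
  have h : ∀ i, |(n i : ℝ)| ≤ ⌈M⌉ := fun i =>
    ((PiLp.norm_apply_le (WithLp.toLp 2 fun i => (n i : ℝ) : EuclideanSpace ℝ (Fin d)) i).trans
      (hs _ hxs)).trans (Int.le_ceil M)
  refine ⟨n, ⟨fun i => ?_, fun i => ?_⟩, rfl⟩
  · exact_mod_cast (abs_le.1 (h i)).1
  · exact_mod_cast (abs_le.1 (h i)).2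

theorem exists_sub_mem_halfOpenCube (x : EuclideanSpace ℝ (Fin d)) :
    ∃ l ∈ intLattice d, x - l ∈ halfOpenCube d := by
  refine ⟨WithLp.toLp 2 fun i => (⌈x i - 1 / 2⌉ : ℝ), fun i => ⟨_, rfl⟩, fun i => ?_⟩
  have h₁ := Int.le_ceil (x i - 1 / 2)
  have h₂ := Int.ceil_lt_add_one (x i - 1 / 2)
  constructor <;> simp only [PiLp.sub_apply] <;> linarith

theorem eq_of_sub_mem_intLattice {x y : EuclideanSpace ℝ (Fin d)} (hx : x ∈ halfOpenCube d)
    (hy : y ∈ halfOpenCube d) (h : x - y ∈ intLattice d) : x = y := by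
  ext i
  obtain ⟨n, hn⟩ := h i
  rw [PiLp.sub_apply] at hn
  obtain ⟨hx₁, hx₂⟩ := hx i
  obtain ⟨hy₁, hy₂⟩ := hy i
  have h₁ : (n : ℝ) < 1 := by linarith
  have h₂ : (-1 : ℝ) < n := by linarith
  have h₀ : n = 0 := by
    have h₁ : n < 1 := by exact_mod_cast h₁
    have h₂ : -1 < n := by exact_mod_cast h₂
    omega
  rw [h₀, Int.cast_zero] at hn
  linarith

theorem norm_le_of_mem_halfOpenCube {x : EuclideanSpace ℝ (Fin d)} (hx : x ∈ halfOpenCube d) :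
    ‖x‖ ≤ Real.sqrt d / 2 := by
  rw [EuclideanSpace.norm_eq, Real.sqrt_le_left (by positivity), div_pow,
    Real.sq_sqrt (Nat.cast_nonneg d)]
  calc ∑ i, ‖x i‖ ^ 2 ≤ ∑ _i : Fin d, (1 / 2 : ℝ) ^ 2 := by
        gcongr with i
        exact abs_le.2 ⟨(hx i).1.le, (hx i).2⟩
    _ = d / 2 ^ 2 := by simp; ring

theorem mem_halfOpenCube_of_norm_lt {x : EuclideanSpace ℝ (Fin d)} (hx : ‖x‖ < 1 / 2) :
    x ∈ halfOpenCube d := fun i => by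
  have h := abs_lt.1 ((PiLp.norm_apply_le x i).trans_lt hx)
  exact ⟨h.1, h.2.le⟩

theorem measurableSet_halfOpenCube : MeasurableSet (halfOpenCube d) := by
  have h : halfOpenCube d = ⋂ i : Fin d, (fun x => x i) ⁻¹' Set.Ioc (-(1 / 2) : ℝ) (1 / 2) := by
    ext x
    simp [halfOpenCube]
  rw [h]
  exact MeasurableSet.iInter fun i => measurableSet_Ioc.preimage (by fun_prop)

theorem volume_halfOpenCube_ne_zero : volume (halfOpenCube d) ≠ 0 := by
  refine ((Metric.measure_ball_pos volume 0 (by norm_num : (0 : ℝ) < 1 / 2)).trans_le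
    (measure_mono fun x hx => ?_)).ne'
  exact mem_halfOpenCube_of_norm_lt (mem_ball_zero_iff.1 hx)

theorem volume_halfOpenCube_ne_top : volume (halfOpenCube d) ≠ ⊤ :=
  ((measure_mono fun _ hx => mem_closedBall_zero_iff.2 (norm_le_of_mem_halfOpenCube hx)).trans_lt
    measure_closedBall_lt_top).ne

/-- Division with remainder by a similarity `B` of ratio `c > 1 + √d` decreases the norm of a
lattice point by a fixed amount, unless the quotient is zero. -/
theorem exists_intLattice_quotient
    {B : EuclideanSpace ℝ (Fin d) ≃ₗ[ℝ] EuclideanSpace ℝ (Fin d)}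
    (hBL : ∀ x ∈ intLattice d, B x ∈ intLattice d) {c : ℝ} (hc : 1 + Real.sqrt d < c)
    (hsim : ∀ x, ‖B x‖ = c * ‖x‖) {l : EuclideanSpace ℝ (Fin d)} (hl : l ∈ intLattice d) :
    ∃ l' ∈ intLattice d,
      l - B l' ∈ (intLattice d : Set (EuclideanSpace ℝ (Fin d))) ∩ B '' halfOpenCube d ∧
        (l' = 0 ∨ ‖l'‖ ≤ ‖l‖ - (c - 1 - Real.sqrt d) / 2) := by
  obtain ⟨l', hl', hq⟩ := exists_sub_mem_halfOpenCube (B.symm l)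
  refine ⟨l', hl', ⟨sub_mem hl (hBL l' hl'), _, hq, by simp⟩, ?_⟩
  have hnorm : ‖l‖ = c * ‖B.symm l‖ := by rw [← hsim, B.apply_symm_apply]
  rcases lt_or_ge ‖B.symm l‖ (1 / 2) with h | h
  · left
    have := eq_of_sub_mem_intLattice (mem_halfOpenCube_of_norm_lt h) hq (by simpa using hl')
    exact sub_eq_self.1 this.symm
  · right
    have h₁ : ‖l'‖ ≤ ‖B.symm l‖ + ‖B.symm l - l'‖ := by
      rw [norm_sub_rev]
      exact norm_le_norm_add_norm_sub' _ _
    have h₂ := norm_le_of_mem_halfOpenCube hq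
    have h₃ := Real.sqrt_nonneg d
    rw [hnorm]
    nlinarith

end Lattice

/-- Strichartz's tiling theorem: with `B` an (invertible) linear
similarity of ratio `c > 1 + √d` mapping the lattice `L = ℤ^d` into itself and
`R = ℤ^d ∩ B((−1/2,1/2]^d)`, the self-affine set
`T = {∑_{j≥1} B^{−j} a_j : a_j ∈ R}` satisfies `B(T) = ⋃_{r∈R} (T + r)` and
tiles `ℝ^d` by integer translates. -/
theorem statement18 (d : ℕ)
    (B : EuclideanSpace ℝ (Fin d) ≃ₗ[ℝ] EuclideanSpace ℝ (Fin d))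
    (L : Set (EuclideanSpace ℝ (Fin d)))
    (hL : L = {x : EuclideanSpace ℝ (Fin d) | ∀ i : Fin d, ∃ n : ℤ, x i = (n : ℝ)})
    (hBL : ∀ x ∈ L, B x ∈ L)
    (c : ℝ) (hc : 1 + Real.sqrt d < c)
    (hsim : ∀ x : EuclideanSpace ℝ (Fin d), ‖B x‖ = c * ‖x‖)
    (R : Set (EuclideanSpace ℝ (Fin d)))
    (hR : R = L ∩ (⇑B '' {x : EuclideanSpace ℝ (Fin d) |
      ∀ i : Fin d, x i ∈ Set.Ioc (-(1 / 2) : ℝ) (1 / 2)}))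
    (T : Set (EuclideanSpace ℝ (Fin d)))
    (hT : T = {x : EuclideanSpace ℝ (Fin d) |
      ∃ a : ℕ → EuclideanSpace ℝ (Fin d), (∀ j : ℕ, a j ∈ R) ∧
        HasSum (fun j : ℕ => (B.symm ^ (j + 1)) (a j)) x}) :
    (⇑B '' T = ⋃ r ∈ R, (fun t => t + r) '' T) ∧
    ((⋃ k ∈ L, (fun t => t + k) '' T) = Set.univ) ∧
    (∀ k ∈ L, ∀ j ∈ L, k ≠ j →
      volume (((fun t => t + k) '' T) ∩ ((fun t => t + j) '' T)) = 0) := by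
  have hL' : L = (intLattice d : Set (EuclideanSpace ℝ (Fin d))) := hL
  have hR' : R = (intLattice d : Set (EuclideanSpace ℝ (Fin d))) ∩ B '' halfOpenCube d := by
    rw [hR, hL']
    rfl
  have hT' : T = digitTile B R := hT
  clear hL hR hT
  subst hL'
  have h₀ := Real.sqrt_nonneg d
  have hc1 : 1 < c := by linarith
  have hBQ : ∀ x ∈ B '' halfOpenCube d, ‖x‖ ≤ c * (Real.sqrt d / 2) := by
    rintro _ ⟨q, hq, rfl⟩
    rw [hsim]
    gcongr
    exact norm_le_of_mem_halfOpenCube hq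
  have hfin : R.Finite := hR' ▸ finite_intLattice_inter_of_norm_le hBQ
  have hzero : (0 : EuclideanSpace ℝ (Fin d)) ∈ R := by
    rw [hR']
    exact ⟨zero_mem (intLattice d), 0, mem_halfOpenCube_of_norm_lt (by simp), map_zero B⟩
  have hdiv : ∀ l ∈ intLattice d, ∃ l' ∈ intLattice d,
      l - B l' ∈ R ∧ (l' = 0 ∨ ‖l'‖ ≤ ‖l‖ - (c - 1 - Real.sqrt d) / 2) := fun l hl => by
    rw [hR']
    exact exists_intLattice_quotient hBL hc hsim hl
  have hround : ∀ x, ∃ l ∈ intLattice d, ‖x - l‖ ≤ Real.sqrt d / 2 := fun x =>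
    (exists_sub_mem_halfOpenCube x).imp fun _ h => ⟨h.1, norm_le_of_mem_halfOpenCube h.2⟩
  have hcompact := isCompact_digitTile hc1 hsim hfin
  subst hT'
  lift R to Finset (EuclideanSpace ℝ (Fin d)) using hfin
  refine ⟨image_digitTile B R, ?_, fun k hk j hj hkj => ?_⟩
  · exact iUnion_digitTile_eq_univ hc1 hsim R.finite_toSet hzero isClosed_intLattice
      (fun l hl => (hdiv l hl).imp fun _ h => ⟨h.1, h.2.1⟩) hround
  · exact measure_translates_inter_eq_zero volume hcompact
      (card_le_abs_det volume hBL measurableSet_halfOpenCube volume_halfOpenCube_ne_zero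
        volume_halfOpenCube_ne_top exists_sub_mem_halfOpenCube
        (fun _ hx _ hy => eq_of_sub_mem_intLattice hx hy) R hR'.subset)
      (by linarith) hdiv hk hj hkj
end
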